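/- arXiv:1301.3346 — 10 statements merged into one kernel-verified Lean document; each statement's English description precedes it below -/
import Mathlib

section
/- Let m ≥ 2 and let Q : ℝ → (m×m real symmetric matrices) be differentiable at t₀. Then the coefficient d₂ of λ^{m−2} in the polynomial det(λ·Q(t₀) − Q'(t₀)) = Σ_{h=0}^m d_h λ^{m−h} equals (1/2)·trace(Q'(t₀) · (d/dt adj Q(t))|_{t=t₀}), where adj denotes the adjugate (cofactor) matrix. -/
open Matrix

/-- The derivative of a determinant is the sum over the columns of the determinants obtained by
differentiating that column. -/
theorem hasDerivAt_det_updateCol {n : Type*} [Fintype n] [DecidableEq n]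
    {M : ℝ → Matrix n n ℝ} {M' : Matrix n n ℝ} {t : ℝ}
    (hM : ∀ i j, HasDerivAt (fun s => M s i j) (M' i j) t) :
    HasDerivAt (fun s => (M s).det) (∑ i, ((M t).updateCol i (fun k => M' k i)).det) t := by
  have h : HasDerivAt (fun s => ∑ σ : Equiv.Perm n, ((Equiv.Perm.sign σ : ℤ) : ℝ) *
      ∏ i, M s (σ i) i) (∑ σ : Equiv.Perm n, ((Equiv.Perm.sign σ : ℤ) : ℝ) *
      ∑ i, (∏ j ∈ Finset.univ.erase i, M t (σ j) j) • M' (σ i) i) t :=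
    HasDerivAt.fun_sum fun σ _ => HasDerivAt.const_mul _
      (HasDerivAt.fun_finsetProd fun i _ => hM (σ i) i)
  simp only [det_apply']
  convert h using 1
  rw [Finset.sum_comm]
  refine Finset.sum_congr rfl fun σ _ => ?_
  rw [← Finset.mul_sum]
  congr 1
  refine Finset.sum_congr rfl fun i _ => ?_
  rw [← Finset.mul_prod_erase _ _ (Finset.mem_univ i), updateCol_self, smul_eq_mul, mul_comm]
  congr 1
  refine Finset.prod_congr rfl fun j hj => ?_
  rw [updateCol_ne (Finset.ne_of_mem_erase hj)]

/-- Jacobi's formula. -/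
theorem hasDerivAt_det {n : Type*} [Fintype n] [DecidableEq n]
    {M : ℝ → Matrix n n ℝ} {M' : Matrix n n ℝ} {t : ℝ}
    (hM : ∀ i j, HasDerivAt (fun s => M s i j) (M' i j) t) :
    HasDerivAt (fun s => (M s).det) (trace (M' * (M t).adjugate)) t := by
  convert hasDerivAt_det_updateCol hM using 1
  rw [trace_mul_comm]
  refine Finset.sum_congr rfl fun i _ => ?_
  rw [← cramer_apply, cramer_eq_adjugate_mulVec]
  rfl

/-- The derivative of the adjugate depends only on the value and the derivative of the matrix. -/
theorem hasDerivAt_adjugate_congr {n : Type*} [Fintype n] [DecidableEq n]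
    {M N : ℝ → Matrix n n ℝ} {M' A' : Matrix n n ℝ} {s t : ℝ}
    (hM : ∀ i j, HasDerivAt (fun x => M x i j) (M' i j) s)
    (hN : ∀ i j, HasDerivAt (fun x => N x i j) (M' i j) t) (hMN : M s = N t)
    (hA : ∀ i j, HasDerivAt (fun x => (M x).adjugate i j) (A' i j) s) (i j : n) :
    HasDerivAt (fun x => (N x).adjugate i j) (A' i j) t := by
  have key : ∀ {P : ℝ → Matrix n n ℝ} {r : ℝ},
      (∀ i j, HasDerivAt (fun x => P x i j) (M' i j) r) → ∀ k l,
      HasDerivAt (fun x => (P x).updateRow j (Pi.single i 1) k l) (M'.updateRow j 0 k l) r := by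
    intro P r hP k l
    by_cases hk : k = j
    · subst hk
      simpa using hasDerivAt_const r _
    · simpa [updateRow_ne hk] using hP k l
  have h₁ := hasDerivAt_det (key hM)
  have h₂ := hasDerivAt_det (key hN)
  simp only [← adjugate_apply] at h₁ h₂
  rw [(hA i j).unique h₁, hMN]
  exact h₂

/-- Reversing the polynomial `det (λ A - B)` gives `det (A + s B)`. -/
theorem det_add_smul_eq_sum {m : ℕ} {A B : Matrix (Fin m) (Fin m) ℝ} {d : ℕ → ℝ}
    (hd : ∀ lam : ℝ,
      (lam • A - B).det = ∑ h ∈ Finset.range (m + 1), d h * lam ^ (m - h)) (s : ℝ) :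
    (A + s • B).det = ∑ h ∈ Finset.range (m + 1), d h * (-s) ^ h := by
  have hne : Set.EqOn (fun s : ℝ => (A + s • B).det)
      (fun s => ∑ h ∈ Finset.range (m + 1), d h * (-s) ^ h) {0}ᶜ := by
    intro s hs
    have hs : -s ≠ 0 := neg_ne_zero.2 hs
    have hAB : A + s • B = (-s) • ((-s)⁻¹ • A - B) := by
      rw [smul_sub, smul_smul, mul_inv_cancel₀ hs, one_smul, neg_smul, sub_neg_eq_add]
    simp only
    rw [hAB, det_smul, hd, Fintype.card_fin, Finset.mul_sum]
    refine Finset.sum_congr rfl fun h hh => ?_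
    have hm : h + (m - h) = m := by have := Finset.mem_range.1 hh; omega
    nth_rewrite 1 [← hm]
    rw [pow_add, inv_pow]
    field_simp
  exact congrFun (Continuous.ext_on (dense_compl_singleton 0) (by fun_prop) (by fun_prop) hne) s

/-- For `Q : ℝ → (m×m real symmetric matrices)`, `m ≥ 2`, differentiable
(entrywise) at `t₀` with derivative `Q'`, the coefficient `d₂` of `λ^{m−2}` in
`det(λ·Q(t₀) − Q') = Σ_{h=0}^m d_h λ^{m−h}` equals
`(1/2)·trace(Q' · (d/dt adj Q(t))|_{t₀})`, where `adj` is the adjugate matrix. -/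
theorem stmt3 (m : ℕ) (hm : 2 ≤ m) (Q : ℝ → Matrix (Fin m) (Fin m) ℝ) (t₀ : ℝ)
    (hsymm : ∀ t, (Q t).IsSymm)
    (Q' : Matrix (Fin m) (Fin m) ℝ)
    (hQ' : ∀ i j, HasDerivAt (fun t => Q t i j) (Q' i j) t₀)
    (A' : Matrix (Fin m) (Fin m) ℝ)
    (hA' : ∀ i j, HasDerivAt (fun t => (Q t).adjugate i j) (A' i j) t₀)
    (d : ℕ → ℝ)
    (hd : ∀ lam : ℝ,
      (lam • Q t₀ - Q').det = ∑ h ∈ Finset.range (m + 1), d h * lam ^ (m - h)) :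
    d 2 = (1 / 2 : ℝ) * Matrix.trace (Q' * A') := by
  have hL : ∀ s i j, HasDerivAt (fun s : ℝ => (Q t₀ + s • Q') i j) (Q' i j) s := by
    intro s i j
    simpa using ((hasDerivAt_id s).mul_const (Q' i j)).const_add (Q t₀ i j)
  have hadj := hasDerivAt_adjugate_congr hQ' (hL 0) (by simp) hA'
  have hsecond : HasDerivAt (fun s : ℝ => trace (Q' * (Q t₀ + s • Q').adjugate))
      (trace (Q' * A')) 0 := by
    simp only [trace, diag, mul_apply]
    exact HasDerivAt.fun_sum fun i _ => HasDerivAt.fun_sum fun j _ => (hadj j i).const_mul _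
  have hfirst : ∀ s : ℝ, trace (Q' * (Q t₀ + s • Q').adjugate) =
      ∑ h ∈ Finset.range (m + 1), d h * (h * (-s) ^ (h - 1) * -1) := by
    intro s
    refine (hasDerivAt_det (hL s)).unique ?_
    simp only [det_add_smul_eq_sum hd]
    exact HasDerivAt.fun_sum fun h _ => ((hasDerivAt_neg s).fun_pow h).const_mul _
  simp only [hfirst] at hsecond
  have hsum := hsecond.unique (HasDerivAt.fun_sum fun h _ =>
    ((((hasDerivAt_neg (0 : ℝ)).fun_pow (h - 1)).const_mul (h : ℝ)).mul_const (-1)).const_mul (d h))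
  rw [Finset.sum_eq_single_of_mem 2 (Finset.mem_range.2 (by omega))] at hsum
  · rw [hsum]
    norm_num
    ring
  · intro h _ h2
    rcases h with _ | _ | _ | h
    · simp
    · simp
    · exact absurd rfl h2
    · simp
end

section
/- Let m ≥ 2 and let S be a set. For each s ∈ S let Q(s) be a real symmetric positive definite m×m matrix and R(s) a real symmetric m×m matrix. Define Δ(s) = det Q(s) > 0, write det(λ·Q(s) − R(s)) = Σ_{h=0}^m d_h(s) λ^{m−h}, and set ψ(s) = d₂(s) and Δ̃(s) = Δ(s) + d₁(s)²/Δ(s). Then the quantity √(Δ(s)/Δ̃(s)) · |⟨R(s)V, V⟩| / ⟨Q(s)V, V⟩ is uniformly bounded over all s ∈ S and all nonzero V ∈ ℝ^m if and only if |ψ(s)|/Δ̃(s) is uniformly bounded over s ∈ S. -/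
open Matrix

open Polynomial in
/-- The three lowest coefficients of `∏ (1 - μ i X)`, expressed through power sums. -/
theorem coeff_prod_one_sub_C_mul_X {ι : Type*} (s : Finset ι) (μ : ι → ℝ) :
    (∏ i ∈ s, (1 - C (μ i) * X)).coeff 0 = 1 ∧
    (∏ i ∈ s, (1 - C (μ i) * X)).coeff 1 = -∑ i ∈ s, μ i ∧
    2 * (∏ i ∈ s, (1 - C (μ i) * X)).coeff 2 = (∑ i ∈ s, μ i) ^ 2 - ∑ i ∈ s, μ i ^ 2 := by
  classical
  induction s using Finset.induction_on with
  | empty => simp [coeff_one]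
  | insert a s ha ih =>
    obtain ⟨h0, h1, h2⟩ := ih
    rw [Finset.prod_insert ha, Finset.sum_insert ha, Finset.sum_insert ha]
    generalize ∏ i ∈ s, (1 - C (μ i) * X) = p at *
    have key (n : ℕ) : ((1 - C (μ a) * X) * p).coeff (n + 1)
        = p.coeff (n + 1) - μ a * p.coeff n := by
      rw [sub_mul, one_mul, coeff_sub, mul_assoc, coeff_C_mul, coeff_X_mul]
    refine ⟨by simp [h0, sub_mul, mul_assoc], ?_, ?_⟩
    · rw [key 0, h0, h1]; ring
    · rw [key 1, h1]; linear_combination h2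

open scoped MatrixOrder in
/-- A positive definite and a symmetric real matrix are simultaneously diagonalised by a
congruence. -/
theorem Matrix.PosDef.exists_simultaneous_diagonalization {n : Type*} [Fintype n] [DecidableEq n]
    {Q R : Matrix n n ℝ} (hQ : Q.PosDef) (hR : R.IsSymm) :
    ∃ (B : Matrix n n ℝ) (μ : n → ℝ), IsUnit B ∧ Q = Bᵀ * B ∧ R = Bᵀ * diagonal μ * B := by
  obtain ⟨A, hQA⟩ := CStarAlgebra.nonneg_iff_eq_star_mul_self.mp hQ.posSemidef.nonneg
  rw [star_eq_conjTranspose, conjTranspose_eq_transpose_of_trivial] at hQA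
  subst hQA
  have hAd : IsUnit A.det := by
    have h := hQ.det_pos.ne'
    rw [det_mul] at h
    exact (right_ne_zero_of_mul h).isUnit
  have hA : IsUnit A := (Matrix.isUnit_iff_isUnit_det A).2 hAd
  have hM : ((A⁻¹)ᵀ * R * A⁻¹).IsHermitian := by
    simp only [Matrix.IsHermitian, conjTranspose_eq_transpose_of_trivial, transpose_mul,
      transpose_transpose, hR.eq, mul_assoc]
  set U : Matrix n n ℝ := hM.eigenvectorUnitary.1
  have hUU : U * Uᵀ = 1 := by
    have := Unitary.coe_mul_star_self hM.eigenvectorUnitary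
    simpa [star_eq_conjTranspose] using this
  have hspec : (A⁻¹)ᵀ * R * A⁻¹ = U * diagonal hM.eigenvalues * Uᵀ := by
    have := hM.spectral_theorem
    simpa [Unitary.conjStarAlgAut_apply, star_eq_conjTranspose, Function.comp_def] using this
  have hAt : Aᵀ * (A⁻¹)ᵀ = 1 := by
    rw [← transpose_mul, nonsing_inv_mul _ hAd, transpose_one]
  refine ⟨Uᵀ * A, hM.eigenvalues, ?_, ?_, ?_⟩
  · exact (IsUnit.of_mul_eq_one U (mul_eq_one_comm.1 hUU)).mul hA
  · rw [transpose_mul, transpose_transpose, mul_assoc,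
      ← mul_assoc U, hUU, one_mul]
  · calc R = (Aᵀ * (A⁻¹)ᵀ) * R * (A⁻¹ * A) := by
          rw [hAt, nonsing_inv_mul _ hAd, one_mul, mul_one]
      _ = Aᵀ * ((A⁻¹)ᵀ * R * A⁻¹) * A := by simp only [mul_assoc]
      _ = Aᵀ * (U * diagonal hM.eigenvalues * Uᵀ) * A :=
          congrArg (fun M => Aᵀ * M * A) hspec
      _ = _ := by simp only [transpose_mul, transpose_transpose, mul_assoc]

theorem transpose_mul_diagonal_mul_mulVec_dotProduct {n : Type*} [Fintype n] [DecidableEq n]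
    (B : Matrix n n ℝ) (μ V : n → ℝ) :
    (Bᵀ * diagonal μ * B).mulVec V ⬝ᵥ V = ∑ i, μ i * (B.mulVec V) i ^ 2 := by
  rw [← mulVec_mulVec, ← mulVec_mulVec, mulVec_transpose, ← dotProduct_mulVec]
  simp only [dotProduct, mulVec_diagonal]
  exact Finset.sum_congr rfl fun i _ => by ring

theorem transpose_mul_self_mulVec_dotProduct {n : Type*} [Fintype n] [DecidableEq n]
    (B : Matrix n n ℝ) (V : n → ℝ) :
    (Bᵀ * B).mulVec V ⬝ᵥ V = ∑ i, (B.mulVec V) i ^ 2 := by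
  simpa using transpose_mul_diagonal_mul_mulVec_dotProduct B (fun _ => 1) V

open Polynomial in
/-- The coefficients of the generalised Hamilton–Cayley polynomial of a simultaneously
diagonalised pair. -/
theorem hamiltonCayley_coeff {m : ℕ} (hm : 2 ≤ m) (B : Matrix (Fin m) (Fin m) ℝ)
    (μ : Fin m → ℝ) (d : ℕ → ℝ)
    (hd : ∀ lam : ℝ, (lam • (Bᵀ * B) - Bᵀ * diagonal μ * B).det
      = ∑ h ∈ Finset.range (m + 1), d h * lam ^ (m - h)) :
    d 1 = -((Bᵀ * B).det * ∑ i, μ i) ∧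
    2 * d 2 = (Bᵀ * B).det * ((∑ i, μ i) ^ 2 - ∑ i, μ i ^ 2) := by
  have hdet (lam : ℝ) : (lam • (Bᵀ * B) - Bᵀ * diagonal μ * B).det
      = (Bᵀ * B).det * ∏ i, (lam - μ i) := by
    have : lam • (Bᵀ * B) - Bᵀ * diagonal μ * B
        = Bᵀ * diagonal (fun i => lam - μ i) * B := by
      have : diagonal (fun i => lam - μ i) = lam • (1 : Matrix (Fin m) (Fin m) ℝ) - diagonal μ := by
        rw [smul_one_eq_diagonal, diagonal_sub]
      rw [this, mul_sub, sub_mul, mul_smul_comm, mul_one, smul_mul_assoc]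
    rw [this, det_mul, det_mul, det_mul, det_diagonal]
    ring
  have hpoly : ∑ h ∈ Finset.range (m + 1), C (d h) * X ^ h
      = C (Bᵀ * B).det * ∏ i, (1 - C (μ i) * X) := by
    refine eq_of_infinite_eval_eq _ _ ((Set.finite_singleton (0 : ℝ)).infinite_compl.mono ?_)
    intro t (ht : t ≠ 0)
    have h := (hd t⁻¹).symm.trans (hdet t⁻¹)
    have hprod : ∏ i, (1 - μ i * t) = t ^ m * ∏ i, (t⁻¹ - μ i) := by
      have : t ^ m = ∏ _i : Fin m, t := by simp
      rw [this, ← Finset.prod_mul_distrib]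
      exact Finset.prod_congr rfl fun i _ => by field_simp
    have hsum : ∑ h ∈ Finset.range (m + 1), d h * t ^ h
        = t ^ m * ∑ h ∈ Finset.range (m + 1), d h * t⁻¹ ^ (m - h) := by
      rw [Finset.mul_sum]
      refine Finset.sum_congr rfl fun h hh => ?_
      have hle : h ≤ m := Nat.lt_succ_iff.1 (Finset.mem_range.1 hh)
      have : t ^ m = t ^ h * t ^ (m - h) := by rw [← pow_add, Nat.add_sub_cancel' hle]
      rw [this, inv_pow]
      field_simp
    simp only [Set.mem_ofPred_eq, eval_finsetSum, eval_mul, eval_C, eval_pow, eval_X,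
      eval_prod, eval_sub, eval_one]
    rw [hprod, hsum, h]
    ring
  obtain ⟨-, h1, h2⟩ := coeff_prod_one_sub_C_mul_X Finset.univ μ
  have hcoeff (k : ℕ) (hk : k ≤ m) :
      d k = (Bᵀ * B).det * (∏ i, (1 - C (μ i) * X)).coeff k := by
    have := congrArg (fun p => p.coeff k) hpoly
    rw [finsetSum_coeff, coeff_C_mul] at this
    simpa [coeff_X_pow, Nat.lt_succ_iff.2 hk, hk, -det_mul] using this
  constructor
  · rw [hcoeff 1 (by omega), h1]; ring
  · rw [hcoeff 2 hm, ← h2]; ring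

/-- Generalised eigenvalues of a symmetric pair: they are values of the Rayleigh quotient, their
`ℓ²` norm bounds it, and they determine the Hamilton–Cayley coefficients. -/
theorem exists_generalised_eigenvalues {m : ℕ} (hm : 2 ≤ m) {Q R : Matrix (Fin m) (Fin m) ℝ}
    (hQ : Q.PosDef) (hR : R.IsSymm) (d : ℕ → ℝ)
    (hd : ∀ lam : ℝ, (lam • Q - R).det = ∑ h ∈ Finset.range (m + 1), d h * lam ^ (m - h)) :
    ∃ μ : Fin m → ℝ,
      (∀ V, |R.mulVec V ⬝ᵥ V| ≤ √(∑ i, μ i ^ 2) * (Q.mulVec V ⬝ᵥ V)) ∧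
      (∀ i, ∃ V, V ≠ 0 ∧ Q.mulVec V ⬝ᵥ V = 1 ∧ R.mulVec V ⬝ᵥ V = μ i) ∧
      d 1 = -(Q.det * ∑ i, μ i) ∧
      2 * d 2 = Q.det * ((∑ i, μ i) ^ 2 - ∑ i, μ i ^ 2) := by
  obtain ⟨B, μ, hB, rfl, rfl⟩ := hQ.exists_simultaneous_diagonalization hR
  refine ⟨μ, fun V => ?_, fun i => ?_, hamiltonCayley_coeff hm B μ d hd⟩
  · rw [transpose_mul_diagonal_mul_mulVec_dotProduct, transpose_mul_self_mulVec_dotProduct,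
      Finset.mul_sum]
    refine (Finset.abs_sum_le_sum_abs _ _).trans (Finset.sum_le_sum fun i _ => ?_)
    rw [abs_mul, abs_sq]
    refine mul_le_mul_of_nonneg_right (Real.abs_le_sqrt ?_) (sq_nonneg _)
    exact Finset.single_le_sum (f := fun i => μ i ^ 2) (fun j _ => sq_nonneg _)
      (Finset.mem_univ i)
  · have hBV : B.mulVec (B⁻¹.mulVec (Pi.single i 1)) = Pi.single i 1 := by
      rw [mulVec_mulVec, mul_nonsing_inv _ ((Matrix.isUnit_iff_isUnit_det B).1 hB), one_mulVec]
    refine ⟨B⁻¹.mulVec (Pi.single i 1), fun h0 => ?_, ?_, ?_⟩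
    · rw [h0, mulVec_zero] at hBV
      simpa using congrFun hBV i
    · rw [transpose_mul_self_mulVec_dotProduct, hBV]
      simp [Pi.single_apply]
    · rw [transpose_mul_diagonal_mul_mulVec_dotProduct, hBV]
      simp [Pi.single_apply]

/-- Lemma on the check function: for families `Q(s)` (real symmetric
positive definite) and `R(s)` (real symmetric) of `m×m` matrices, `m ≥ 2`, with
`Δ(s) = det Q(s)`, generalised Hamilton–Cayley coefficients
`det(λQ(s) − R(s)) = Σ_h d_h(s) λ^{m−h}`, check function `ψ(s) = d₂(s)` and
`Δ̃(s) = Δ(s) + d₁(s)²/Δ(s)`, the quantity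
`√(Δ/Δ̃)·|⟨R(s)V,V⟩|/⟨Q(s)V,V⟩` is uniformly bounded over `s ∈ S`, `V ≠ 0`
iff `|ψ(s)|/Δ̃(s)` is uniformly bounded over `s ∈ S`. -/
theorem stmt5 {S : Type*} (m : ℕ) (hm : 2 ≤ m)
    (Q R : S → Matrix (Fin m) (Fin m) ℝ)
    (hQ : ∀ s, (Q s).PosDef) (hR : ∀ s, (R s).IsSymm)
    (d : S → ℕ → ℝ)
    (hd : ∀ s, ∀ lam : ℝ,
      (lam • Q s - R s).det = ∑ h ∈ Finset.range (m + 1), d s h * lam ^ (m - h)) :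
    (∃ K : ℝ, ∀ s : S, ∀ V : Fin m → ℝ, V ≠ 0 →
        Real.sqrt ((Q s).det / ((Q s).det + (d s 1) ^ 2 / (Q s).det)) *
            |(R s).mulVec V ⬝ᵥ V| / ((Q s).mulVec V ⬝ᵥ V) ≤ K) ↔
      (∃ K : ℝ, ∀ s : S,
        |d s 2| / ((Q s).det + (d s 1) ^ 2 / (Q s).det) ≤ K) := by
  choose μ hle heq hd1 hd2 using fun s =>
    exists_generalised_eigenvalues hm (hQ s) (hR s) (d s) (hd s)
  have hΔ (s : S) : 0 < (Q s).det := (hQ s).det_pos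
  have hpos (s : S) : 0 < 1 + (∑ i, μ s i) ^ 2 := by positivity
  have hΔt (s : S) : (Q s).det + d s 1 ^ 2 / (Q s).det
      = (Q s).det * (1 + (∑ i, μ s i) ^ 2) := by
    have := (hΔ s).ne'
    rw [hd1]
    field_simp
  have hratio (s : S) : (Q s).det / ((Q s).det * (1 + (∑ i, μ s i) ^ 2))
      = (1 + (∑ i, μ s i) ^ 2)⁻¹ := by
    have := (hΔ s).ne'
    have := (hpos s).ne'
    field_simp
  have hψ (s : S) : |d s 2| / ((Q s).det * (1 + (∑ i, μ s i) ^ 2))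
      = |(∑ i, μ s i) ^ 2 - ∑ i, μ s i ^ 2| / (2 * (1 + (∑ i, μ s i) ^ 2)) := by
    have h : d s 2 = (Q s).det * ((∑ i, μ s i) ^ 2 - ∑ i, μ s i ^ 2) / 2 := by
      linarith [hd2 s]
    have := (hΔ s).ne'
    have := (hpos s).ne'
    rw [h, abs_div, abs_mul, abs_of_pos (hΔ s), abs_two]
    field_simp
  simp only [hΔt, hratio, hψ]
  constructor
  · rintro ⟨K, hK⟩
    refine ⟨(1 + m * K ^ 2) / 2, fun s => ?_⟩
    have hμ (i : Fin m) : μ s i ^ 2 ≤ K ^ 2 * (1 + (∑ i, μ s i) ^ 2) := by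
      obtain ⟨V, hV, hQV, hRV⟩ := heq s i
      have h := hK s V hV
      rw [hQV, hRV, div_one] at h
      have h2 := pow_le_pow_left₀ (by positivity) h 2
      rwa [mul_pow, Real.sq_sqrt (inv_nonneg.2 (hpos s).le), sq_abs, inv_mul_le_iff₀ (hpos s),
        mul_comm] at h2
    have hsum : ∑ i, μ s i ^ 2 ≤ m * (K ^ 2 * (1 + (∑ i, μ s i) ^ 2)) := by
      simpa using Finset.sum_le_card_nsmul Finset.univ _ _ fun i _ => hμ i
    have hnn : 0 ≤ ∑ i, μ s i ^ 2 := by positivity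
    rw [div_le_iff₀ (mul_pos two_pos (hpos s)), abs_le]
    constructor <;> nlinarith [sq_nonneg (∑ i, μ s i)]
  · rintro ⟨K, hK⟩
    refine ⟨√(1 + 2 * K), fun s V hV => ?_⟩
    have hQV : 0 < (Q s).mulVec V ⬝ᵥ V := by
      simpa [dotProduct_comm] using (hQ s).dotProduct_mulVec_pos hV
    have hsum : ∑ i, μ s i ^ 2 ≤ (1 + 2 * K) * (1 + (∑ i, μ s i) ^ 2) := by
      have h := hK s
      rw [div_le_iff₀ (mul_pos two_pos (hpos s))] at h
      nlinarith [neg_abs_le ((∑ i, μ s i) ^ 2 - ∑ i, μ s i ^ 2)]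
    rw [div_le_iff₀ hQV]
    calc √(1 + (∑ i, μ s i) ^ 2)⁻¹ * |(R s).mulVec V ⬝ᵥ V|
        ≤ √(1 + (∑ i, μ s i) ^ 2)⁻¹ * (√(∑ i, μ s i ^ 2) * ((Q s).mulVec V ⬝ᵥ V)) :=
          mul_le_mul_of_nonneg_left (hle s V) (Real.sqrt_nonneg _)
      _ = √((1 + (∑ i, μ s i) ^ 2)⁻¹ * ∑ i, μ s i ^ 2) * ((Q s).mulVec V ⬝ᵥ V) := by
          rw [Real.sqrt_mul (inv_nonneg.2 (hpos s).le), mul_assoc]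
      _ ≤ √(1 + 2 * K) * ((Q s).mulVec V ⬝ᵥ V) := by
          refine mul_le_mul_of_nonneg_right (Real.sqrt_le_sqrt ?_) hQV.le
          rwa [inv_mul_le_iff₀ (hpos s), mul_comm]
end

section
/- Let I ⊆ ℝ be an open interval, let Q : I → (m×m complex Hermitian matrices) be continuously differentiable, let A, B : I → (m×m complex matrices) be continuous, let a : I → ℝ be continuous, and let V : I → ℂ^m be differentiable with V'(t) = i(a(t)A(t) + B(t))V(t) for all t ∈ I. If Q(t)A(t) = A(t)*Q(t) for all t ∈ I, then the energy E(t) = ⟨Q(t)V(t), V(t)⟩ is differentiable on I with E'(t) = ⟨Q'(t)V(t), V(t)⟩ + i·⟨(Q(t)B(t) − B(t)*Q(t))V(t), V(t)⟩. -/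
open Matrix

theorem HasDerivAt.dotProduct {n : Type*} [Fintype n] {u v : ℝ → n → ℂ} {u' v' : n → ℂ} {t : ℝ}
    (hu : HasDerivAt u u' t) (hv : HasDerivAt v v' t) :
    HasDerivAt (fun s => u s ⬝ᵥ v s) (u' ⬝ᵥ v t + u t ⬝ᵥ v') t := by
  simp only [_root_.dotProduct, ← Finset.sum_add_distrib]
  exact HasDerivAt.fun_sum fun i _ => (hasDerivAt_pi.1 hu i).mul (hasDerivAt_pi.1 hv i)

theorem HasDerivAt.matrix_mulVec {k n : Type*} [Fintype k] [Fintype n] {M : ℝ → Matrix k n ℂ}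
    {M' : Matrix k n ℂ} {v : ℝ → n → ℂ} {v' : n → ℂ} {t : ℝ}
    (hM : ∀ i j, HasDerivAt (fun s => M s i j) (M' i j) t) (hv : HasDerivAt v v' t) :
    HasDerivAt (fun s => M s *ᵥ v s) (M' *ᵥ v t + M t *ᵥ v') t :=
  hasDerivAt_pi.2 fun i => HasDerivAt.dotProduct (hasDerivAt_pi.2 (hM i)) hv

/-- If `QA = A*Q` and `c` is real, the contribution of `c A` to the derivative of the quadratic
form of `Q` along `W = i(c A + B)v` cancels. -/
theorem star_dotProduct_add_of_symmetrizer {n : Type*} [Fintype n] {Q A : Matrix n n ℂ}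
    (B : Matrix n n ℂ) (c : ℝ) (v : n → ℂ) (h : Q * A = Aᴴ * Q) :
    star (Complex.I • (((c : ℂ) • A + B) *ᵥ v)) ⬝ᵥ (Q *ᵥ v) +
        star v ⬝ᵥ (Q *ᵥ (Complex.I • (((c : ℂ) • A + B) *ᵥ v))) =
      Complex.I * (star v ⬝ᵥ ((Q * B - Bᴴ * Q) *ᵥ v)) := by
  have hc : star (c : ℂ) = c := Complex.conj_ofReal c
  have hI : star Complex.I = -Complex.I := Complex.conj_I
  rw [star_smul, star_mulVec, smul_dotProduct, ← dotProduct_mulVec, mulVec_mulVec, mulVec_smul,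
    dotProduct_smul, mulVec_mulVec, conjTranspose_add, conjTranspose_smul, hc, hI, add_mul,
    mul_add, smul_mul_assoc, mul_smul_comm, h]
  simp only [add_mulVec, sub_mulVec, dotProduct_add, dotProduct_sub, smul_eq_mul]
  ring

/-- For `Q` a `C¹` family of Hermitian matrices on the open interval
`I = (α, β)`, `A, B` continuous matrix families, `a` continuous real-valued, and `V`
differentiable with `V' = i(a A + B)V` on `I`, if `QA = A*Q` on `I` then the energy
`E(t) = ⟨Q(t)V(t), V(t)⟩` is differentiable on `I` with
`E' = ⟨Q'V, V⟩ + i⟨(QB − B*Q)V, V⟩`. -/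
theorem stmt8 (m : ℕ) (α β : ℝ)
    (Q Q' A B : ℝ → Matrix (Fin m) (Fin m) ℂ) (a : ℝ → ℝ)
    (V : ℝ → (Fin m → ℂ))
    (hQHerm : ∀ t ∈ Set.Ioo α β, (Q t).IsHermitian)
    (hQd : ∀ t ∈ Set.Ioo α β, ∀ i j, HasDerivAt (fun s => Q s i j) (Q' t i j) t)
    (hQ'c : ∀ i j, ContinuousOn (fun t => Q' t i j) (Set.Ioo α β))
    (hAc : ∀ i j, ContinuousOn (fun t => A t i j) (Set.Ioo α β))
    (hBc : ∀ i j, ContinuousOn (fun t => B t i j) (Set.Ioo α β))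
    (hac : ContinuousOn a (Set.Ioo α β))
    (hV : ∀ t ∈ Set.Ioo α β,
      HasDerivAt V (Complex.I • (((a t : ℂ) • A t + B t).mulVec (V t))) t)
    (hQA : ∀ t ∈ Set.Ioo α β, Q t * A t = (A t)ᴴ * Q t) :
    ∀ t ∈ Set.Ioo α β,
      HasDerivAt (fun s => star (V s) ⬝ᵥ ((Q s).mulVec (V s)))
        (star (V t) ⬝ᵥ ((Q' t).mulVec (V t)) +
          Complex.I * (star (V t) ⬝ᵥ ((Q t * B t - (B t)ᴴ * Q t).mulVec (V t)))) t := by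
  intro t ht
  have hv := hV t ht
  refine (hv.star.dotProduct (HasDerivAt.matrix_mulVec (hQd t ht) hv)).congr_deriv ?_
  rw [← star_dotProduct_add_of_symmetrizer (B t) (a t) (V t) (hQA t ht), dotProduct_add]
  ring
end

section
/- Let f be a real-analytic function on an open interval around t' ∈ ℝ such that f(t) = (t − t')^{2k} g(t), where k ≥ 1 is an integer and g is real-analytic with g(t') ≠ 0. Then there exist an open interval J around t' and a real-analytic function h on J such that h(t) = f(t) + f'(t)²/f(t) for all t ∈ J with t ≠ t', and h vanishes at t' exactly of order 2k − 2; that is, h(t) = (t − t')^{2k−2} u(t) with u real-analytic on J and u(t') ≠ 0. -/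
/-- If `f` is real-analytic on an open interval around `t'` with
`f(t) = (t − t')^{2k} g(t)`, `k ≥ 1`, `g` real-analytic and `g(t') ≠ 0`, then on some
open interval `J` around `t'` there is a real-analytic `h` with
`h = f + f'²/f` away from `t'`, and `h` vanishes at `t'` exactly of order `2k − 2`:
`h(t) = (t − t')^{2k−2} u(t)` with `u` real-analytic on `J` and `u(t') ≠ 0`. -/
theorem stmt10 (u v t' : ℝ) (ht' : t' ∈ Set.Ioo u v) (k : ℕ) (hk : 1 ≤ k)
    (f g : ℝ → ℝ)
    (hf : AnalyticOnNhd ℝ f (Set.Ioo u v))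
    (hg : AnalyticOnNhd ℝ g (Set.Ioo u v))
    (hfg : ∀ t ∈ Set.Ioo u v, f t = (t - t') ^ (2 * k) * g t)
    (hg0 : g t' ≠ 0) :
    ∃ u' v', t' ∈ Set.Ioo u' v' ∧ Set.Ioo u' v' ⊆ Set.Ioo u v ∧
      ∃ h w : ℝ → ℝ,
        AnalyticOnNhd ℝ h (Set.Ioo u' v') ∧
        AnalyticOnNhd ℝ w (Set.Ioo u' v') ∧
        (∀ t ∈ Set.Ioo u' v', t ≠ t' → h t = f t + (deriv f t) ^ 2 / f t) ∧
        (∀ t ∈ Set.Ioo u' v', h t = (t - t') ^ (2 * k - 2) * w t) ∧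
        w t' ≠ 0 := by
  obtain ⟨m, rfl⟩ : ∃ m, k = m + 1 := ⟨k - 1, by omega⟩
  have hmem : ∀ᶠ t in nhds t', t ∈ Set.Ioo u v ∧ g t ≠ 0 :=
    (isOpen_Ioo.eventually_mem ht').and ((hg t' ht').continuousAt.eventually_ne hg0)
  obtain ⟨a, b, hab, hsub⟩ := mem_nhds_iff_exists_Ioo_subset.mp hmem
  have hgJ : AnalyticOnNhd ℝ g (Set.Ioo a b) := hg.mono fun t ht => (hsub ht).1
  have hs : AnalyticOnNhd ℝ (fun t : ℝ => t - t') (Set.Ioo a b) :=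
    analyticOnNhd_id.sub analyticOnNhd_const
  have hw : AnalyticOnNhd ℝ (fun t => (t - t') ^ 2 * g t +
      (2 * ((m : ℝ) + 1) * g t + (t - t') * deriv g t) ^ 2 / g t) (Set.Ioo a b) :=
    ((hs.pow 2).mul hgJ).add
      ((((analyticOnNhd_const.mul hgJ).add (hs.mul hgJ.deriv)).pow 2).div hgJ
        fun t ht => (hsub ht).2)
  refine ⟨a, b, hab, fun t ht => (hsub ht).1, _, _, (hs.pow (2 * (m + 1) - 2)).mul hw, hw,
    fun t ht hne => ?_, fun t _ => rfl, ?_⟩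
  · obtain ⟨htI, hgt⟩ := hsub ht
    have hst : t - t' ≠ 0 := sub_ne_zero.mpr hne
    have hderiv : deriv f t = 2 * ((m : ℝ) + 1) * (t - t') ^ (2 * m + 1) * g t +
        (t - t') ^ (2 * m + 2) * deriv g t := by
      have hloc : f =ᶠ[nhds t] fun x => (x - t') ^ (2 * (m + 1)) * g x :=
        Filter.eventuallyEq_of_mem (isOpen_Ioo.mem_nhds htI) hfg
      have hd := (((hasDerivAt_id t).sub_const t').pow (2 * (m + 1))).mul
        (hg t htI).differentiableAt.hasDerivAt
      rw [hloc.deriv_eq]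
      refine hd.deriv.trans ?_
      simp only [id, Pi.pow_apply, show 2 * (m + 1) - 1 = 2 * m + 1 by omega]
      push_cast
      ring
    rw [hderiv, hfg t htI]
    simp only [Pi.pow_apply, show 2 * (m + 1) - 2 = 2 * m by omega]
    field_simp
    ring
  · have hm : (m : ℝ) + 1 ≠ 0 := by positivity
    simp [hg0, hm]
end

section
/- Let f be a nonnegative real-analytic function on an open interval containing the compact interval [a,b], with f not identically zero on [a,b]. Then f has finitely many zeros t₁,…,t_N in [a,b], and, setting Z(t) = ∏_{j=1}^N |t − t_j| (with Z ≡ 1 if f has no zeros in [a,b]), there exist constants c₁, c₂ > 0 such that c₁·f(t)/Z(t)² ≤ f(t) + f'(t)²/f(t) ≤ c₂·f(t)/Z(t)² for every t ∈ [a,b] with f(t) > 0. -/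
open Set Filter Topology

theorem ContinuousAt.exists_eventually_mem_Icc {X : Type*} [TopologicalSpace X] {V : X → ℝ} {x : X}
    (hV : ContinuousAt V x) (hx : 0 < V x) :
    ∃ c₁ > (0 : ℝ), ∃ c₂ > (0 : ℝ), ∀ᶠ t in 𝓝 x, c₁ ≤ V t ∧ V t ≤ c₂ := by
  refine ⟨V x / 2, by positivity, V x + 1, by positivity, ?_⟩
  filter_upwards [hV.eventually_const_lt (half_lt_self hx),
    hV.eventually_lt_const (lt_add_one (V x))] with t h₁ h₂
  exact ⟨h₁.le, h₂.le⟩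

theorem AnalyticOnNhd.finite_zeros_of_isCompact {f : ℝ → ℝ} {U K : Set ℝ}
    (hf : AnalyticOnNhd ℝ f U) (hU : IsPreconnected U) (hK : IsCompact K) (hKU : K ⊆ U)
    (hne : ∃ t ∈ U, f t ≠ 0) : {t ∈ K | f t = 0}.Finite := by
  by_contra hinf
  obtain ⟨x, hxK, hx⟩ := Set.Infinite.exists_accPt_of_subset_isCompact hinf hK (sep_subset _ _)
  obtain ⟨t, htU, ht⟩ := hne
  refine ht (hf.eqOn_zero_of_preconnected_of_frequently_eq_zero hU (hKU hxK) ?_ htU)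
  exact (accPt_iff_frequently_nhdsNE.mp hx).mono fun y hy => hy.2

theorem AnalyticAt.eventually_sub_mul_logDeriv {f : ℝ → ℝ} {x : ℝ} (hf : AnalyticAt ℝ f x)
    (hf₀ : f x = 0) (hne : ¬ ∀ᶠ t in 𝓝 x, f t = 0) :
    ∃ L : ℝ → ℝ, ContinuousAt L x ∧ L x ≠ 0 ∧
      ∀ᶠ t in 𝓝 x, f t ≠ 0 → (t - x) * (deriv f t / f t) = L t := by
  obtain ⟨n, g, hg, hgx, hfg⟩ := hf.exists_eventuallyEq_pow_smul_nonzero_iff.mpr hne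
  have hn : n ≠ 0 := by
    rintro rfl
    have := hfg.self_of_nhds
    simp [hf₀] at this
    exact hgx this.symm
  refine ⟨fun t => n + (t - x) * (deriv g t / g t), ?_, by simpa using hn, ?_⟩
  · have h₁ := hg.continuousAt
    have h₂ := hg.deriv.continuousAt
    fun_prop (disch := assumption)
  · filter_upwards [hfg.eventually_nhds, hg.eventually_analyticAt,
      hg.continuousAt.eventually_ne hgx] with t ht hgt hgt₀ hft
    have hval : f t = (t - x) ^ n * g t := by simpa using ht.self_of_nhds
    have htx : t - x ≠ 0 := by
      intro h
      simp [hval, h, hn] at hft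
    have hder : deriv f t = n * (t - x) ^ (n - 1) * g t + (t - x) ^ n * deriv g t := by
      have h := ((((hasDerivAt_id t).sub_const x).pow n).mul
        hgt.differentiableAt.hasDerivAt).congr_of_eventuallyEq
          (f₁ := f) (ht.mono fun y hy => by simpa using hy)
      simpa using h.deriv
    obtain ⟨m, rfl⟩ := Nat.exists_eq_succ_of_ne_zero hn
    rw [hder, hval]
    simp only [Nat.succ_eq_add_one, Nat.add_sub_cancel]
    field_simp
    ring

theorem AnalyticAt.exists_bounds_sq_mul_one_add_sq_logDeriv {f : ℝ → ℝ} {x : ℝ}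
    (hf : AnalyticAt ℝ f x) (hne : ¬ ∀ᶠ t in 𝓝 x, f t = 0) {Z : Finset ℝ}
    (hZ : x ∈ Z ↔ f x = 0) :
    ∃ c₁ > (0 : ℝ), ∃ c₂ > (0 : ℝ), ∀ᶠ t in 𝓝 x, f t ≠ 0 →
      c₁ ≤ (∏ z ∈ Z, |t - z|) ^ 2 * (1 + (deriv f t / f t) ^ 2) ∧
      (∏ z ∈ Z, |t - z|) ^ 2 * (1 + (deriv f t / f t) ^ 2) ≤ c₂ := by
  have hprod : ∀ S : Finset ℝ, x ∉ S → ∏ z ∈ S, |x - z| ≠ 0 := fun S hS =>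
    Finset.prod_ne_zero_iff.mpr fun z hz => by
      rw [abs_ne_zero, sub_ne_zero]
      rintro rfl
      exact hS hz
  suffices h : ∃ V : ℝ → ℝ, ContinuousAt V x ∧ 0 < V x ∧ ∀ᶠ t in 𝓝 x, f t ≠ 0 →
      (∏ z ∈ Z, |t - z|) ^ 2 * (1 + (deriv f t / f t) ^ 2) = V t by
    obtain ⟨V, hV, hVx, hVeq⟩ := h
    obtain ⟨c₁, hc₁, c₂, hc₂, hb⟩ := hV.exists_eventually_mem_Icc hVx
    refine ⟨c₁, hc₁, c₂, hc₂, ?_⟩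
    filter_upwards [hVeq, hb] with t h₁ h₂ hft
    rwa [h₁ hft]
  by_cases hfx : f x = 0
  · obtain ⟨L, hL, hLx, hLeq⟩ := hf.eventually_sub_mul_logDeriv hfx hne
    refine ⟨fun t => (∏ z ∈ Z.erase x, |t - z|) ^ 2 * ((t - x) ^ 2 + L t ^ 2), by fun_prop, ?_, ?_⟩
    · have := hprod (Z.erase x) (Finset.notMem_erase x Z)
      positivity
    · filter_upwards [hLeq] with t ht hft
      rw [← ht hft, ← Finset.mul_prod_erase Z _ (hZ.mpr hfx), mul_pow, sq_abs]
      ring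
  · refine ⟨fun t => (∏ z ∈ Z, |t - z|) ^ 2 * (1 + (deriv f t / f t) ^ 2), ?_, ?_,
      Eventually.of_forall fun t _ => rfl⟩
    · have h₁ := hf.continuousAt
      have h₂ := hf.deriv.continuousAt
      fun_prop (disch := assumption)
    · have := hprod Z (mt hZ.mp hfx)
      positivity

theorem IsCompact.exists_bounds_of_eventually {X : Type*} [TopologicalSpace X] {K : Set X}
    (hK : IsCompact K) {p : X → Prop} {W : X → ℝ}
    (h : ∀ x ∈ K, ∃ c₁ > (0 : ℝ), ∃ c₂ > (0 : ℝ), ∀ᶠ t in 𝓝 x, p t → c₁ ≤ W t ∧ W t ≤ c₂) :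
    ∃ c₁ > (0 : ℝ), ∃ c₂ > (0 : ℝ), ∀ t ∈ K, p t → c₁ ≤ W t ∧ W t ≤ c₂ := by
  refine hK.induction_on
    (p := fun s => ∃ c₁ > (0 : ℝ), ∃ c₂ > (0 : ℝ), ∀ t ∈ s, p t → c₁ ≤ W t ∧ W t ≤ c₂)
    ⟨1, one_pos, 1, one_pos, by simp⟩ ?_ ?_ ?_
  · rintro s t hst ⟨c₁, hc₁, c₂, hc₂, hb⟩
    exact ⟨c₁, hc₁, c₂, hc₂, fun y hy => hb y (hst hy)⟩
  · rintro s t ⟨c₁, hc₁, c₂, hc₂, hs⟩ ⟨d₁, hd₁, d₂, hd₂, ht⟩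
    refine ⟨min c₁ d₁, lt_min hc₁ hd₁, max c₂ d₂, lt_max_of_lt_left hc₂, ?_⟩
    rintro y (hy | hy) hpy
    · exact ⟨(min_le_left _ _).trans (hs y hy hpy).1, (hs y hy hpy).2.trans (le_max_left _ _)⟩
    · exact ⟨(min_le_right _ _).trans (ht y hy hpy).1, (ht y hy hpy).2.trans (le_max_right _ _)⟩
  · intro x hx
    obtain ⟨c₁, hc₁, c₂, hc₂, hb⟩ := h x hx
    exact ⟨_, mem_nhdsWithin_of_mem_nhds hb, c₁, hc₁, c₂, hc₂, fun t ht => ht⟩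

/-- A nonnegative real-analytic function `f` on an open interval
containing `[a,b]`, not identically zero on `[a,b]`, has finitely many zeros
`t₁,…,t_N` in `[a,b]`, and with `Z(t) = ∏_j |t − t_j|` (empty product `= 1`) there are
`c₁, c₂ > 0` with `c₁ f/Z² ≤ f + f'²/f ≤ c₂ f/Z²` wherever `f > 0` on `[a,b]`. -/
theorem stmt11 (a b u v : ℝ) (hab : a < b) (hua : u < a) (hbv : b < v)
    (f : ℝ → ℝ)
    (hf : AnalyticOnNhd ℝ f (Set.Ioo u v))
    (hpos : ∀ t ∈ Set.Ioo u v, 0 ≤ f t)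
    (hnz : ∃ t ∈ Set.Icc a b, f t ≠ 0) :
    ∃ Z : Finset ℝ, (Z : Set ℝ) = {t ∈ Set.Icc a b | f t = 0} ∧
      ∃ c₁ > (0 : ℝ), ∃ c₂ > (0 : ℝ), ∀ t ∈ Set.Icc a b, 0 < f t →
        c₁ * f t / (∏ z ∈ Z, |t - z|) ^ 2 ≤ f t + (deriv f t) ^ 2 / f t ∧
        f t + (deriv f t) ^ 2 / f t ≤ c₂ * f t / (∏ z ∈ Z, |t - z|) ^ 2 := by
  have hsub : Icc a b ⊆ Ioo u v := Icc_subset_Ioo hua hbv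
  obtain ⟨t₀, ht₀, hft₀⟩ := hnz
  have hfin := hf.finite_zeros_of_isCompact isPreconnected_Ioo isCompact_Icc hsub
    ⟨t₀, hsub ht₀, hft₀⟩
  have hmem : ∀ x ∈ Icc a b, x ∈ hfin.toFinset ↔ f x = 0 := fun x hx => by simp [hx.1, hx.2]
  refine ⟨hfin.toFinset, hfin.coe_toFinset, ?_⟩
  obtain ⟨c₁, hc₁, c₂, hc₂, hb⟩ := isCompact_Icc.exists_bounds_of_eventually fun x hx =>
    (hf x (hsub hx)).exists_bounds_sq_mul_one_add_sq_logDeriv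
      (fun h => hft₀ (hf.eqOn_zero_of_preconnected_of_eventuallyEq_zero isPreconnected_Ioo
        (hsub hx) h (hsub ht₀))) (hmem x hx)
  refine ⟨c₁, hc₁, c₂, hc₂, fun t ht hft => ?_⟩
  obtain ⟨h₁, h₂⟩ := hb t ht hft.ne'
  have hP : 0 < (∏ z ∈ hfin.toFinset, |t - z|) ^ 2 := by
    refine pow_pos (Finset.prod_pos fun z hz => abs_pos.mpr (sub_ne_zero.mpr ?_)) 2
    rintro rfl
    exact hft.ne' ((hmem t ht).mp hz)
  have heq : f t + deriv f t ^ 2 / f t = f t * (1 + (deriv f t / f t) ^ 2) := by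
    field_simp
  rw [heq, div_le_iff₀ hP, le_div_iff₀ hP]
  constructor
  · linarith [mul_le_mul_of_nonneg_left h₁ hft.le]
  · linarith [mul_le_mul_of_nonneg_left h₂ hft.le]
end

section
/- Let f be a nonnegative real-analytic function on an open interval containing the compact interval [a,b], with f not identically zero on [a,b]. Then there exist constants c₁, c₂ > 0 and natural numbers p, q such that for every ε ∈ (0, e^{−1}] there exists a subset A_ε ⊆ [a,b] with the following properties: A_ε is a union of at most p intervals; the Lebesgue measure of A_ε is at most ε; min_{t ∈ [a,b]∖A_ε} f(t) ≥ c₁ ε^{2q} · sup_{t ∈ [a,b]} f(t); and ∫_{[a,b]∖A_ε} |f'(t)|/f(t) dt ≤ c₂ · log(1/ε). -/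
open MeasureTheory

open Filter Topology

/-- Off a finite set `Z`, the function `f` is bounded below on `s` by a power of the distance to `Z`
and its logarithmic derivative has at most simple poles at `Z`. -/
def HasZeroBounds (f : ℝ → ℝ) (s : Set ℝ) : Prop :=
  ∃ (Z : Finset ℝ) (c : ℝ) (n : ℕ) (C : ℝ), 0 < c ∧ 0 ≤ C ∧
    (∀ t ∈ s, ∀ δ : ℝ, 0 < δ → δ ≤ 1 → (∀ z ∈ Z, δ ≤ |t - z|) → c * δ ^ n ≤ |f t|) ∧
    (∀ t ∈ s, t ∉ Z → |deriv f t| ≤ C * (1 + ∑ z ∈ Z, |t - z|⁻¹) * |f t|)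

theorem HasZeroBounds.mono {f : ℝ → ℝ} {s t : Set ℝ} (hst : s ⊆ t) (h : HasZeroBounds f t) :
    HasZeroBounds f s := by
  obtain ⟨Z, c, n, C, hc, hC, h1, h2⟩ := h
  exact ⟨Z, c, n, C, hc, hC, fun x hx => h1 x (hst hx), fun x hx => h2 x (hst hx)⟩

theorem HasZeroBounds.union {f : ℝ → ℝ} {s t : Set ℝ} (hs : HasZeroBounds f s)
    (ht : HasZeroBounds f t) : HasZeroBounds f (s ∪ t) := by
  obtain ⟨Z, c, n, C, hc, hC, h1, h2⟩ := hs
  obtain ⟨Z', c', n', C', hc', hC', h1', h2'⟩ := ht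
  have lower : ∀ {d : ℝ} {m : ℕ} {δ : ℝ}, 0 < d → min c c' ≤ d → m ≤ max n n' → 0 < δ → δ ≤ 1 →
      min c c' * δ ^ max n n' ≤ d * δ ^ m := fun hd hcd hm h0 hle =>
    mul_le_mul hcd (pow_le_pow_of_le_one h0.le hle hm) (by positivity) hd.le
  have upper : ∀ {W : Finset ℝ} {D x : ℝ}, W ⊆ Z ∪ Z' → 0 ≤ D → D ≤ max C C' →
      D * (1 + ∑ z ∈ W, |x - z|⁻¹) * |f x| ≤
        max C C' * (1 + ∑ z ∈ Z ∪ Z', |x - z|⁻¹) * |f x| := by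
    intro W D x hW hD hDC
    have := Finset.sum_le_sum_of_subset_of_nonneg (f := fun z => |x - z|⁻¹) hW
      (fun _ _ _ => by positivity)
    have h0 : 0 ≤ ∑ z ∈ W, |x - z|⁻¹ := Finset.sum_nonneg fun _ _ => by positivity
    gcongr
  refine ⟨Z ∪ Z', min c c', max n n', max C C', lt_min hc hc', hC.trans (le_max_left _ _), ?_, ?_⟩
  · rintro x (hx | hx) δ h0 hle hz
    · exact (lower hc (min_le_left _ _) (le_max_left _ _) h0 hle).trans
        (h1 x hx δ h0 hle fun z hzZ => hz z (Finset.mem_union_left _ hzZ))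
    · exact (lower hc' (min_le_right _ _) (le_max_right _ _) h0 hle).trans
        (h1' x hx δ h0 hle fun z hzZ => hz z (Finset.mem_union_right _ hzZ))
  · rintro x (hx | hx) hxZ
    · exact (h2 x hx fun h => hxZ (Finset.mem_union_left _ h)).trans
        (upper Finset.subset_union_left hC (le_max_left _ _))
    · exact (h2' x hx fun h => hxZ (Finset.mem_union_right _ h)).trans
        (upper Finset.subset_union_right hC' (le_max_right _ _))

theorem AnalyticAt.exists_hasZeroBounds {f : ℝ → ℝ} {x : ℝ} (hf : AnalyticAt ℝ f x)
    (hne : ¬ ∀ᶠ t in 𝓝 x, f t = 0) : ∃ s ∈ 𝓝 x, HasZeroBounds f s := by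
  obtain ⟨n, g, hg, hgx, hfg⟩ := hf.exists_eventuallyEq_pow_smul_nonzero_iff.mpr hne
  have hm : 0 < |g x| := abs_pos.mpr hgx
  have hlow : ∀ᶠ t in 𝓝 x, |g x| / 2 < |g t| :=
    hg.continuousAt.abs.eventually (lt_mem_nhds (half_lt_self hm))
  have hup : ∀ᶠ t in 𝓝 x, |deriv g t| < |deriv g x| + 1 :=
    hg.deriv.continuousAt.abs.eventually (gt_mem_nhds (lt_add_one _))
  refine ⟨_, hlow.and (hup.and (hfg.eventually_nhds.and hg.eventually_analyticAt)), {x},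
    |g x| / 2, n, n + (|deriv g x| + 1) / (|g x| / 2), by positivity, by positivity, ?_, ?_⟩
  · rintro t ⟨hlt, -, heq, -⟩ δ h0 - hz
    have hd : δ ≤ |t - x| := hz x (Finset.mem_singleton_self x)
    rw [heq.self_of_nhds, smul_eq_mul, abs_mul, abs_pow, mul_comm]
    gcongr
  · rintro t ⟨hlt, hdt, heq, hgt⟩ htx
    have hsub : t - x ≠ 0 := sub_ne_zero.mpr fun h => htx (Finset.mem_singleton.mpr h)
    have hr : 0 < |t - x| := abs_pos.mpr hsub
    have hder : HasDerivAt f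
        ((n * (t - x) ^ (n - 1) * 1) * g t + (t - x) ^ n * deriv g t) t :=
      ((((hasDerivAt_id t).sub_const x).pow n).mul
        hgt.differentiableAt.hasDerivAt).congr_of_eventuallyEq heq
    have hpow : (n : ℝ) * |t - x| ^ (n - 1) = n * |t - x|⁻¹ * |t - x| ^ n := by
      cases n with
      | zero => simp
      | succ k => simp only [Nat.add_sub_cancel, pow_succ]; field_simp
    have hK : |deriv g t| ≤ (|deriv g x| + 1) / (|g x| / 2) * |g t| := by
      rw [div_mul_eq_mul_div, le_div_iff₀ (by positivity)]
      gcongr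
    set K := (|deriv g x| + 1) / (|g x| / 2)
    have hK0 : 0 ≤ K := by positivity
    rw [hder.deriv, heq.self_of_nhds, smul_eq_mul, Finset.sum_singleton]
    calc |n * (t - x) ^ (n - 1) * 1 * g t + (t - x) ^ n * deriv g t|
        ≤ (n * |t - x| ^ (n - 1)) * |g t| + |t - x| ^ n * |deriv g t| := by
          refine (abs_add_le _ _).trans_eq ?_
          simp [abs_mul, abs_pow]
      _ ≤ n * |t - x|⁻¹ * |t - x| ^ n * |g t| + |t - x| ^ n * (K * |g t|) := by
          rw [hpow]; gcongr
      _ = (n * |t - x|⁻¹ + K) * (|t - x| ^ n * |g t|) := by ring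
      _ ≤ (n + K) * (1 + |t - x|⁻¹) * (|t - x| ^ n * |g t|) := by
          gcongr
          have : 0 ≤ K * |t - x|⁻¹ := by positivity
          nlinarith [Nat.cast_nonneg (α := ℝ) n]
      _ = (n + K) * (1 + |t - x|⁻¹) * |(t - x) ^ n * g t| := by rw [abs_mul, abs_pow]

theorem AnalyticOnNhd.hasZeroBounds {f : ℝ → ℝ} {U s : Set ℝ} (hf : AnalyticOnNhd ℝ f U)
    (hU : IsPreconnected U) (hs : IsCompact s) (hsU : s ⊆ U) (hnz : ∃ t ∈ U, f t ≠ 0) :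
    HasZeroBounds f s := by
  refine hs.induction_on ⟨∅, 1, 0, 0, one_pos, le_rfl, by simp, by simp⟩
    (fun _ _ => HasZeroBounds.mono) (fun _ _ => HasZeroBounds.union) fun x hx => ?_
  have hne : ¬ ∀ᶠ t in 𝓝 x, f t = 0 := fun h0 => by
    obtain ⟨t, ht, hft⟩ := hnz
    exact hft (hf.eqOn_zero_of_preconnected_of_eventuallyEq_zero hU (hsU hx) h0 ht)
  obtain ⟨w, hw, hb⟩ := (hf x (hsU hx)).exists_hasZeroBounds hne
  exact ⟨w, mem_nhdsWithin_of_mem_nhds hw, hb⟩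

theorem setOf_le_abs_sub_le_eq_union {z δ M : ℝ} (hδ : 0 < δ) :
    {t : ℝ | δ ≤ |t - z| ∧ |t - z| ≤ M} =
      Set.Icc (z - M) (z - δ) ∪ Set.Icc (z + δ) (z + M) := by
  ext t
  simp only [Set.mem_ofPred_eq, Set.mem_union, Set.mem_Icc]
  rcases abs_cases (t - z) with h | h <;> grind

theorem integrableOn_inv_abs_sub {z δ M : ℝ} (hδ : 0 < δ) :
    IntegrableOn (fun t => |t - z|⁻¹) {t : ℝ | δ ≤ |t - z| ∧ |t - z| ≤ M} := by
  refine ContinuousOn.integrableOn_compact ?_ ?_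
  · rw [setOf_le_abs_sub_le_eq_union hδ]
    exact isCompact_Icc.union isCompact_Icc
  · exact ContinuousOn.inv₀ (by fun_prop) fun t ht => (hδ.trans_le ht.1).ne'

theorem setIntegral_inv_abs_sub {z δ M : ℝ} (hδ : 0 < δ) (hM : δ ≤ M) :
    ∫ t in {t : ℝ | δ ≤ |t - z| ∧ |t - z| ≤ M}, |t - z|⁻¹ = 2 * Real.log (M / δ) := by
  have hint := integrableOn_inv_abs_sub (z := z) (M := M) hδ
  rw [setOf_le_abs_sub_le_eq_union hδ] at hint ⊢
  rw [setIntegral_union (Set.disjoint_left.mpr fun t h h' => by grind) measurableSet_Icc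
    hint.left_of_union hint.right_of_union]
  have hpos : ∫ t in Set.Icc (z + δ) (z + M), |t - z|⁻¹ = Real.log (M / δ) := by
    rw [setIntegral_congr_fun (g := fun t => (t - z)⁻¹) measurableSet_Icc
      fun t ht => by simp only; rw [abs_of_pos (by linarith [ht.1])],
      integral_Icc_eq_integral_Ioc, ← intervalIntegral.integral_of_le (by linarith),
      intervalIntegral.integral_comp_sub_right (fun t => t⁻¹), add_sub_cancel_left,
      add_sub_cancel_left, integral_inv_of_pos hδ (hδ.trans_le hM)]
  have hneg : ∫ t in Set.Icc (z - M) (z - δ), |t - z|⁻¹ = Real.log (M / δ) := by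
    rw [setIntegral_congr_fun (g := fun t => (z - t)⁻¹) measurableSet_Icc
      fun t ht => by simp only; rw [abs_sub_comm, abs_of_pos (by linarith [ht.2])],
      integral_Icc_eq_integral_Ioc, ← intervalIntegral.integral_of_le (by linarith),
      intervalIntegral.integral_comp_sub_left (fun t => t⁻¹), sub_sub_cancel,
      sub_sub_cancel, integral_inv_of_pos hδ (hδ.trans_le hM)]
  rw [hpos, hneg, two_mul]

/-- Integral bound for a function dominated by simple poles, away from the poles. -/
theorem setIntegral_le_of_le_sum_inv_abs_sub {h : ℝ → ℝ} {s : Set ℝ} {Z : Finset ℝ} {M : ℝ → ℝ}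
    {C δ : ℝ} (hs : MeasurableSet s) (hfin : volume s ≠ ⊤) (hδ : 0 < δ) (hC : 0 ≤ C)
    (hM : ∀ z ∈ Z, δ ≤ M z) (hdist : ∀ z ∈ Z, ∀ t ∈ s, δ ≤ |t - z| ∧ |t - z| ≤ M z)
    (h0 : ∀ t ∈ s, 0 ≤ h t) (hle : ∀ t ∈ s, h t ≤ C * (1 + ∑ z ∈ Z, |t - z|⁻¹)) :
    ∫ t in s, h t ≤ C * (volume.real s + ∑ z ∈ Z, 2 * Real.log (M z / δ)) := by
  have hi : ∀ z ∈ Z, IntegrableOn (fun t => |t - z|⁻¹) s := fun z hz =>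
    (integrableOn_inv_abs_sub (M := M z) hδ).mono_set (hdist z hz)
  have h1 : IntegrableOn (fun _ : ℝ => (1 : ℝ)) s := integrableOn_const hfin
  have hsum : IntegrableOn (fun t => ∑ z ∈ Z, |t - z|⁻¹) s := integrable_finsetSum _ hi
  calc ∫ t in s, h t ≤ ∫ t in s, C * (1 + ∑ z ∈ Z, |t - z|⁻¹) :=
        integral_mono_of_nonneg (ae_restrict_of_forall_mem hs h0) ((h1.add hsum).const_mul C)
          (ae_restrict_of_forall_mem hs hle)
    _ = C * (volume.real s + ∑ z ∈ Z, ∫ t in s, |t - z|⁻¹) := by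
        rw [integral_const_mul, integral_add h1 hsum, integral_finsetSum _ hi]
        simp
    _ ≤ C * (volume.real s + ∑ z ∈ Z, 2 * Real.log (M z / δ)) := by
        gcongr with z hz
        rw [← setIntegral_inv_abs_sub hδ (hM z hz)]
        exact setIntegral_mono_set (integrableOn_inv_abs_sub hδ)
          (ae_of_all _ fun t => by simp) (ae_of_all _ (hdist z hz))

/-- Proposition on real-analytic functions: for `f ≥ 0` real-analytic
on an open interval containing `[a,b]`, not identically zero on `[a,b]`, there are
`c₁, c₂ > 0` and `p, q ∈ ℕ` such that for every `ε ∈ (0, e⁻¹]` there is a set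
`A_ε ⊆ [a,b]`, a union of at most `p` intervals, with `|A_ε| ≤ ε`,
`min_{[a,b]∖A_ε} f ≥ c₁ ε^{2q} sup_{[a,b]} f`, and
`∫_{[a,b]∖A_ε} |f'|/f ≤ c₂ log(1/ε)`. -/
theorem stmt12 (a b u v : ℝ) (hab : a < b) (hua : u < a) (hbv : b < v)
    (f : ℝ → ℝ)
    (hf : AnalyticOnNhd ℝ f (Set.Ioo u v))
    (hpos : ∀ t ∈ Set.Ioo u v, 0 ≤ f t)
    (hnz : ∃ t ∈ Set.Icc a b, f t ≠ 0) :
    ∃ c₁ > (0 : ℝ), ∃ c₂ > (0 : ℝ), ∃ p q : ℕ,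
      ∀ ε : ℝ, ε ∈ Set.Ioc 0 (Real.exp (-1)) →
        ∃ A : Set ℝ, A ⊆ Set.Icc a b ∧
          (∃ l r : Fin p → ℝ, A = Set.Icc a b ∩ ⋃ i, Set.Ioo (l i) (r i)) ∧
          volume A ≤ ENNReal.ofReal ε ∧
          (∀ t ∈ Set.Icc a b \ A,
            c₁ * ε ^ (2 * q) * sSup (f '' Set.Icc a b) ≤ f t) ∧
          (∫ t in Set.Icc a b \ A, |deriv f t| / f t) ≤ c₂ * Real.log (1 / ε) := by
  obtain ⟨t₀, ht₀, hft₀⟩ := hnz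
  have hsub : Set.Icc a b ⊆ Set.Ioo u v := Set.Icc_subset_Ioo hua hbv
  obtain ⟨Z, c, n, C, hc, hC, hlow, hder⟩ := hf.hasZeroBounds isPreconnected_Ioo
    isCompact_Icc hsub ⟨t₀, hsub ht₀, hft₀⟩
  have habs : ∀ t ∈ Set.Icc a b, |f t| = f t := fun t ht => abs_of_nonneg (hpos t (hsub ht))
  have hS : 0 ≤ sSup (f '' Set.Icc a b) :=
    Real.sSup_nonneg fun _ ⟨t, ht, h⟩ => h ▸ hpos t (hsub ht)
  set S := sSup (f '' Set.Icc a b)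
  set N : ℝ := 2 * Z.card + 2 with hN
  have hN1 : 1 ≤ N := by
    have : (0 : ℝ) ≤ Z.card := by positivity
    linarith
  have hN0 : 0 < N := by linarith
  set M : ℝ → ℝ := fun z => 1 + |a - z| + |b - z| with hMdef
  have hM1 : ∀ z, 1 ≤ M z := fun z => by
    have := abs_nonneg (a - z)
    have := abs_nonneg (b - z)
    simp only [hMdef]; linarith
  have hMle : ∀ z, ∀ t ∈ Set.Icc a b, |t - z| ≤ M z := fun z t ht => by
    have := abs_le_max_abs_abs (sub_le_sub_right ht.1 z) (sub_le_sub_right ht.2 z)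
    refine this.trans (max_le ?_ ?_) <;> simp only [hMdef] <;>
      linarith [abs_nonneg (a - z), abs_nonneg (b - z)]
  have hlogsum : 0 ≤ ∑ z ∈ Z, 2 * (Real.log (M z) + Real.log N + 1) :=
    Finset.sum_nonneg fun z _ => by
      have := Real.log_nonneg (hM1 z)
      have := Real.log_nonneg hN1
      positivity
  have hba : 0 < b - a := sub_pos.mpr hab
  refine ⟨c / N ^ n / (S + 1), by positivity,
    C * ((b - a) + ∑ z ∈ Z, 2 * (Real.log (M z) + Real.log N + 1)) + 1, by positivity,
    Z.card, n, fun ε ⟨hε, hεe⟩ => ?_⟩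
  have hε1 : ε ≤ 1 := hεe.trans (Real.exp_le_one_iff.mpr (by norm_num))
  have hlog : 1 ≤ Real.log (1 / ε) := by
    have := (Real.log_le_iff_le_exp hε).mpr hεe
    rw [one_div, Real.log_inv]; linarith
  set δ := ε / N with hδ
  have hδ0 : 0 < δ := by positivity
  have hδ1 : δ ≤ 1 := (div_le_self hε.le hN1).trans hε1
  let l : Fin Z.card → ℝ := fun i => Z.equivFin.symm i - δ
  let r : Fin Z.card → ℝ := fun i => Z.equivFin.symm i + δ
  set A : Set ℝ := Set.Icc a b ∩ ⋃ i, Set.Ioo (l i) (r i) with hA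
  have hdist : ∀ z ∈ Z, ∀ t ∈ Set.Icc a b \ A, δ ≤ |t - z| := by
    intro z hz t ht
    by_contra! hlt
    refine ht.2 ⟨ht.1, Set.mem_iUnion.mpr ⟨Z.equivFin ⟨z, hz⟩, ?_⟩⟩
    have := abs_lt.mp hlt
    simp only [l, r, Equiv.symm_apply_apply, Set.mem_Ioo]
    constructor <;> linarith [this.1, this.2]
  have hbelow : ∀ t ∈ Set.Icc a b \ A, c * δ ^ n ≤ f t := fun t ht =>
    habs t ht.1 ▸ hlow t ht.1 δ hδ0 hδ1 fun z hz => hdist z hz t ht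
  have hmeas : MeasurableSet (Set.Icc a b \ A) := measurableSet_Icc.diff
    (measurableSet_Icc.inter (MeasurableSet.iUnion fun _ => measurableSet_Ioo))
  refine ⟨A, Set.inter_subset_left, ⟨l, r, rfl⟩, ?_, fun t ht => ?_, ?_⟩
  · calc volume A ≤ volume (⋃ i, Set.Ioo (l i) (r i)) := measure_mono Set.inter_subset_right
      _ ≤ ∑ i, volume (Set.Ioo (l i) (r i)) := measure_iUnion_fintype_le _ _
      _ = ENNReal.ofReal (∑ _i : Fin Z.card, 2 * δ) := by
          rw [ENNReal.ofReal_sum_of_nonneg fun _ _ => by positivity]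
          refine Finset.sum_congr rfl fun i _ => ?_
          rw [Real.volume_Ioo]; congr 1; simp only [l, r]; ring
      _ ≤ ENNReal.ofReal ε := by
          apply ENNReal.ofReal_le_ofReal
          have : ε = N * δ := by rw [hδ]; field_simp
          rw [Finset.sum_const, Finset.card_univ, Fintype.card_fin, nsmul_eq_mul, this, hN]
          linarith
  · refine le_trans ?_ (hbelow t ht)
    have hpow : ε ^ (2 * n) ≤ ε ^ n := pow_le_pow_of_le_one hε.le hε1 (by omega)
    have hfrac : S / (S + 1) ≤ 1 := (div_le_one (by linarith)).mpr (by linarith)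
    calc c / N ^ n / (S + 1) * ε ^ (2 * n) * S
        = c / N ^ n * ε ^ (2 * n) * (S / (S + 1)) := by ring
      _ ≤ c / N ^ n * ε ^ n * 1 := by gcongr
      _ = c * δ ^ n := by rw [hδ, div_pow]; ring
  · have hfpos : ∀ t ∈ Set.Icc a b \ A, 0 < f t := fun t ht =>
      (by positivity : 0 < c * δ ^ n).trans_le (hbelow t ht)
    have hvol : volume.real (Set.Icc a b \ A) ≤ b - a := by
      refine (measureReal_mono Set.sdiff_subset measure_Icc_lt_top.ne).trans_eq ?_
      rw [Real.volume_real_Icc_of_le hab.le]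
    have hbound := setIntegral_le_of_le_sum_inv_abs_sub (h := fun t => |deriv f t| / f t)
      (Z := Z) (M := M) hmeas (measure_ne_top_of_subset Set.sdiff_subset measure_Icc_lt_top.ne)
      hδ0 hC (fun z _ => hδ1.trans (hM1 z))
      (fun z hz t ht => ⟨hdist z hz t ht, hMle z t ht.1⟩)
      (fun t ht => div_nonneg (abs_nonneg _) (hfpos t ht).le) fun t ht => by
        rw [div_le_iff₀ (hfpos t ht)]
        have := hder t ht.1 fun hz => by simpa using hδ0.trans_le (hdist t hz t ht)
        rwa [habs t ht.1] at this
    set L := Real.log (1 / ε)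
    have hterm : ∀ z, Real.log (M z / δ) ≤ (Real.log (M z) + Real.log N + 1) * L := fun z => by
      have hMz : 0 < M z := one_pos.trans_le (hM1 z)
      have heq : M z / δ = M z * N * (1 / ε) := by rw [hδ]; field_simp
      rw [heq, Real.log_mul (by positivity) (by positivity),
        Real.log_mul (by positivity) (by positivity)]
      nlinarith [Real.log_nonneg (hM1 z), Real.log_nonneg hN1]
    calc _ ≤ _ := hbound
      _ ≤ C * ((b - a) * L + ∑ z ∈ Z, 2 * ((Real.log (M z) + Real.log N + 1) * L)) := by
          gcongr with z hz
          · exact hvol.trans (le_mul_of_one_le_right hba.le hlog)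
          · exact hterm z
      _ = C * ((b - a) + ∑ z ∈ Z, 2 * (Real.log (M z) + Real.log N + 1)) * L := by
          simp only [← mul_assoc, ← Finset.sum_mul]; ring
      _ ≤ _ := by gcongr; linarith
end

section
/- Assume λ₁, λ₂ are as in the context, and suppose there is a constant C > 0 such that ψ(t) ≤ C·Δ̃(t) for all t ∈ (0,T]. Then there exist T' ∈ (0,T] and a constant M > 0 such that t²·λ₁'(t)² + t²·λ₂'(t)² ≤ M·Δ(t) for all t ∈ (0,T']. -/
open Filter Topology Asymptotics in
/-- An analytic function that does not vanish identically near `0` satisfies `t f'(t) = O(f(t))`. -/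
theorem AnalyticAt.isBigO_id_mul_deriv {f : ℝ → ℝ} (hf : AnalyticAt ℝ f 0)
    (hne : ¬ ∀ᶠ t in 𝓝 0, f t = 0) :
    (fun t => t * deriv f t) =O[𝓝 0] f := by
  obtain ⟨n, g, hg, hg0, hfg⟩ := hf.exists_eventuallyEq_pow_smul_nonzero_iff.mpr hne
  have hfg' : f =ᶠ[𝓝 0] fun t => t ^ n * g t := by
    filter_upwards [hfg] with t ht using by simpa using ht
  have hderiv : (fun t => t * deriv f t) =ᶠ[𝓝 0]
      fun t => t ^ n * (n * g t + t * deriv g t) := by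
    filter_upwards [hfg'.deriv, hg.eventually_analyticAt] with t ht hgt
    rw [ht, deriv_fun_mul (differentiableAt_pow n) hgt.differentiableAt, deriv_pow_field]
    cases n with
    | zero => simp
    | succ k => simp only [Nat.add_sub_cancel]; ring
  have hcont : ContinuousAt (fun t => n * g t + t * deriv g t) 0 :=
    (continuousAt_const.mul hg.continuousAt).add (continuousAt_id.mul hg.deriv.continuousAt)
  have hbound : (fun t => n * g t + t * deriv g t) =O[𝓝 0] g :=
    (hcont.tendsto.isBigO_one ℝ).trans
      ((isBigO_const_left_iff_pos_le_norm one_ne_zero).mpr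
        ⟨‖g 0‖ / 2, by positivity, by
          filter_upwards [hg.continuousAt.norm.tendsto.eventually_const_lt
            (half_lt_self (norm_pos_iff.mpr hg0))] with t ht using ht.le⟩)
  exact (((isBigO_refl (fun t : ℝ => t ^ n) (𝓝 0)).mul hbound).congr' hderiv.symm hfg'.symm)

/-- for `λ₁, λ₂` real-analytic on an open interval containing `[0,T]`,
neither identically zero, with `λ₁(0) = λ₂(0) = 0` and `λ₁ ≠ λ₂` on `(0,T]`, set
`Δ = (λ₁ − λ₂)²`, `Δ̃ = Δ + Δ'²/Δ`, `ψ = (λ₁' + λ₂')²`. If `ψ ≤ C·Δ̃` on `(0,T]`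
for some `C > 0`, then there are `T' ∈ (0,T]` and `M > 0` with
`t²λ₁'(t)² + t²λ₂'(t)² ≤ M·Δ(t)` on `(0,T']`. -/
theorem stmt16 (T u v : ℝ) (hT : 0 < T) (hu : u < 0) (hv : T < v)
    (l1 l2 : ℝ → ℝ)
    (hl1 : AnalyticOnNhd ℝ l1 (Set.Ioo u v))
    (hl2 : AnalyticOnNhd ℝ l2 (Set.Ioo u v))
    (hnz1 : ∃ t ∈ Set.Icc (0 : ℝ) T, l1 t ≠ 0)
    (hnz2 : ∃ t ∈ Set.Icc (0 : ℝ) T, l2 t ≠ 0)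
    (h10 : l1 0 = 0) (h20 : l2 0 = 0)
    (hsep : ∀ t ∈ Set.Ioc (0 : ℝ) T, l1 t ≠ l2 t)
    (C : ℝ) (hC : 0 < C)
    (hyp : ∀ t ∈ Set.Ioc (0 : ℝ) T,
      (deriv l1 t + deriv l2 t) ^ 2 ≤
        C * ((l1 t - l2 t) ^ 2 +
          (deriv (fun s => (l1 s - l2 s) ^ 2) t) ^ 2 / (l1 t - l2 t) ^ 2)) :
    ∃ T' ∈ Set.Ioc (0 : ℝ) T, ∃ M > (0 : ℝ), ∀ t ∈ Set.Ioc (0 : ℝ) T',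
      t ^ 2 * (deriv l1 t) ^ 2 + t ^ 2 * (deriv l2 t) ^ 2 ≤
        M * (l1 t - l2 t) ^ 2 := by
  have h0 : (0 : ℝ) ∈ Set.Ioo u v := ⟨hu, hT.trans hv⟩
  have hana : AnalyticAt ℝ (fun s => l1 s - l2 s) 0 := (hl1 0 h0).sub (hl2 0 h0)
  have hne : ¬ ∀ᶠ t in nhds (0 : ℝ), l1 t - l2 t = 0 := by
    intro h
    obtain ⟨t, ht, htT⟩ := ((h.filter_mono nhdsWithin_le_nhds).and
      (Ioc_mem_nhdsGT hT)).exists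
    exact hsep t htT (sub_eq_zero.mp ht)
  obtain ⟨K, hK, hbd⟩ := (hana.isBigO_id_mul_deriv hne).exists_pos
  obtain ⟨ε, hε, hball⟩ := Metric.eventually_nhds_iff.mp hbd.bound
  refine ⟨min T (ε / 2), ⟨by positivity, min_le_left _ _⟩,
    (C * T ^ 2 + (4 * C + 1) * K ^ 2) / 2, by positivity, fun t ht => ?_⟩
  have htT : t ∈ Set.Ioc (0 : ℝ) T := ⟨ht.1, ht.2.trans (min_le_left _ _)⟩
  have htε : dist t 0 < ε := by
    rw [Real.dist_eq, sub_zero, abs_of_pos ht.1]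
    linarith [ht.2.trans (min_le_right _ _)]
  have htuv : t ∈ Set.Ioo u v := ⟨hu.trans ht.1, htT.2.trans_lt hv⟩
  have hd : HasDerivAt (fun s => l1 s - l2 s) (deriv l1 t - deriv l2 t) t :=
    (hl1 t htuv).differentiableAt.hasDerivAt.sub (hl2 t htuv).differentiableAt.hasDerivAt
  have hd0 : l1 t - l2 t ≠ 0 := sub_ne_zero.mpr (hsep t htT)
  have hsum : (deriv l1 t + deriv l2 t) ^ 2 ≤
      C * ((l1 t - l2 t) ^ 2 + 4 * (deriv l1 t - deriv l2 t) ^ 2) := by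
    convert hyp t htT using 3
    rw [(hd.fun_pow 2).deriv, eq_div_iff (pow_ne_zero 2 hd0)]
    push_cast
    ring
  have hdiff : t ^ 2 * (deriv l1 t - deriv l2 t) ^ 2 ≤ K ^ 2 * (l1 t - l2 t) ^ 2 := by
    have h := hball htε
    rw [hd.deriv, Real.norm_eq_abs, Real.norm_eq_abs] at h
    have h2 := pow_le_pow_left₀ (abs_nonneg _) h 2
    simpa only [mul_pow, sq_abs] using h2
  have htsq : t ^ 2 ≤ T ^ 2 := pow_le_pow_left₀ ht.1.le htT.2 2
  calc t ^ 2 * (deriv l1 t) ^ 2 + t ^ 2 * (deriv l2 t) ^ 2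
      = (t ^ 2 * (deriv l1 t + deriv l2 t) ^ 2
          + t ^ 2 * (deriv l1 t - deriv l2 t) ^ 2) / 2 := by ring
    _ ≤ (t ^ 2 * (C * ((l1 t - l2 t) ^ 2 + 4 * (deriv l1 t - deriv l2 t) ^ 2))
          + t ^ 2 * (deriv l1 t - deriv l2 t) ^ 2) / 2 := by gcongr
    _ = (C * t ^ 2 * (l1 t - l2 t) ^ 2
          + (4 * C + 1) * (t ^ 2 * (deriv l1 t - deriv l2 t) ^ 2)) / 2 := by ring
    _ ≤ (C * T ^ 2 * (l1 t - l2 t) ^ 2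
          + (4 * C + 1) * (K ^ 2 * (l1 t - l2 t) ^ 2)) / 2 := by gcongr
    _ = _ := by ring
end

section
/- Assume λ₁, λ₂ are as in the context, and suppose there is a constant M > 0 such that t²·λ₁'(t)² + t²·λ₂'(t)² ≤ M·Δ(t) for all t ∈ (0,T]. Then there exist T' ∈ (0,T] and a constant M' > 0 such that λ₁(t)² + λ₂(t)² ≤ M'·Δ(t) for all t ∈ (0,T']. -/
open Filter Topology Asymptotics

/-- A real-analytic function vanishing at `0` is dominated near `0` by its Euler derivative. -/
theorem AnalyticAt.isBigO_mul_deriv {f : ℝ → ℝ} (hf : AnalyticAt ℝ f 0) (h0 : f 0 = 0) :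
    f =O[𝓝 0] fun t => t * deriv f t := by
  by_cases hz : ∀ᶠ t in 𝓝 (0 : ℝ), f t = 0
  · exact EventuallyEq.trans_isBigO hz (isBigO_zero _ _)
  obtain ⟨n, g, hg, hg0, hfg⟩ := hf.exists_eventuallyEq_pow_smul_nonzero_iff.mpr hz
  replace hfg : f =ᶠ[𝓝 0] fun t => t ^ n * g t := by
    simpa only [sub_zero, smul_eq_mul, EventuallyEq] using hfg
  have hn : n ≠ 0 := by
    rintro rfl
    exact hg0 (by simpa [h0] using hfg.eq_of_nhds.symm)
  have hder : (fun t => t * deriv f t) =ᶠ[𝓝 0] fun t => t ^ n * (n * g t + t * deriv g t) := by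
    filter_upwards [hfg.eventuallyEq_nhds, hg.eventually_analyticAt] with t ht hgt
    rw [EventuallyEq.deriv_eq ht,
      ((hasDerivAt_pow n t).fun_mul hgt.differentiableAt.hasDerivAt).deriv]
    obtain ⟨m, rfl⟩ := Nat.exists_eq_succ_of_ne_zero hn
    simp only [Nat.succ_eq_add_one, Nat.add_sub_cancel]
    ring
  have hcont : Tendsto (fun t => n * g t + t * deriv g t) (𝓝 0) (𝓝 (n * g 0)) := by
    have h : ContinuousAt (fun t => n * g t + t * deriv g t) 0 :=
      (continuousAt_const.mul hg.continuousAt).add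
        (continuousAt_id.mul hg.deriv.continuousAt)
    simpa [ContinuousAt] using h
  have hne : (n : ℝ) * g 0 ≠ 0 := mul_ne_zero (Nat.cast_ne_zero.mpr hn) hg0
  have hO : g =O[𝓝 0] fun t => n * g t + t * deriv g t :=
    isBigO_of_div_tendsto_nhds
      ((hcont.eventually_ne hne).mono fun _ h h' => absurd h' h) _
      (hg.continuousAt.tendsto.div hcont hne)
  exact hfg.trans_isBigO
    (((isBigO_refl (fun t : ℝ => t ^ n) _).mul hO).trans_eventuallyEq hder.symm)

/-- for `λ₁, λ₂` real-analytic on an open interval containing `[0,T]`,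
neither identically zero, with `λ₁(0) = λ₂(0) = 0` and `λ₁ ≠ λ₂` on `(0,T]`, set
`Δ = (λ₁ − λ₂)²`. If `t²λ₁'(t)² + t²λ₂'(t)² ≤ M·Δ(t)` on `(0,T]` for some `M > 0`,
then there are `T' ∈ (0,T]` and `M' > 0` with `λ₁(t)² + λ₂(t)² ≤ M'·Δ(t)` on `(0,T']`. -/
theorem stmt17 (T u v : ℝ) (hT : 0 < T) (hu : u < 0) (hv : T < v)
    (l1 l2 : ℝ → ℝ)
    (hl1 : AnalyticOnNhd ℝ l1 (Set.Ioo u v))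
    (hl2 : AnalyticOnNhd ℝ l2 (Set.Ioo u v))
    (hnz1 : ∃ t ∈ Set.Icc (0 : ℝ) T, l1 t ≠ 0)
    (hnz2 : ∃ t ∈ Set.Icc (0 : ℝ) T, l2 t ≠ 0)
    (h10 : l1 0 = 0) (h20 : l2 0 = 0)
    (hsep : ∀ t ∈ Set.Ioc (0 : ℝ) T, l1 t ≠ l2 t)
    (M : ℝ) (hM : 0 < M)
    (hyp : ∀ t ∈ Set.Ioc (0 : ℝ) T,
      t ^ 2 * (deriv l1 t) ^ 2 + t ^ 2 * (deriv l2 t) ^ 2 ≤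
        M * (l1 t - l2 t) ^ 2) :
    ∃ T' ∈ Set.Ioc (0 : ℝ) T, ∃ M' > (0 : ℝ), ∀ t ∈ Set.Ioc (0 : ℝ) T',
      (l1 t) ^ 2 + (l2 t) ^ 2 ≤ M' * (l1 t - l2 t) ^ 2 := by
  have hmem : (0 : ℝ) ∈ Set.Ioo u v := ⟨hu, hT.trans hv⟩
  obtain ⟨C, hC, h1⟩ := ((hl1 0 hmem).isBigO_mul_deriv h10).exists_pos
  obtain ⟨D, hD, h2⟩ := ((hl2 0 hmem).isBigO_mul_deriv h20).exists_pos
  obtain ⟨ε, hε, hball⟩ := Metric.eventually_nhds_iff.mp (h1.bound.and h2.bound)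
  refine ⟨min T (ε / 2), ⟨lt_min hT (half_pos hε), min_le_left _ _⟩, (C ^ 2 + D ^ 2) * M,
    by positivity, fun t ht => ?_⟩
  have htT : t ∈ Set.Ioc (0 : ℝ) T := ⟨ht.1, ht.2.trans (min_le_left _ _)⟩
  have htε : dist t 0 < ε := by
    rw [Real.dist_eq, sub_zero, abs_of_pos ht.1]
    exact (ht.2.trans (min_le_right _ _)).trans_lt (half_lt_self hε)
  obtain ⟨b1, b2⟩ := hball htε
  have sq_bound {a b K : ℝ} (h : ‖a‖ ≤ K * ‖t * b‖) : a ^ 2 ≤ K ^ 2 * (t ^ 2 * b ^ 2) := by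
    have := pow_le_pow_left₀ (norm_nonneg a) h 2
    simpa only [mul_pow, Real.norm_eq_abs, sq_abs] using this
  calc l1 t ^ 2 + l2 t ^ 2
      ≤ C ^ 2 * (t ^ 2 * deriv l1 t ^ 2) + D ^ 2 * (t ^ 2 * deriv l2 t ^ 2) :=
        add_le_add (sq_bound b1) (sq_bound b2)
    _ ≤ (C ^ 2 + D ^ 2) * (t ^ 2 * deriv l1 t ^ 2 + t ^ 2 * deriv l2 t ^ 2) := by
        have p1 : 0 ≤ C ^ 2 * (t ^ 2 * deriv l2 t ^ 2) := by positivity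
        have p2 : 0 ≤ D ^ 2 * (t ^ 2 * deriv l1 t ^ 2) := by positivity
        linarith
    _ ≤ (C ^ 2 + D ^ 2) * M * (l1 t - l2 t) ^ 2 := by
        rw [mul_assoc]
        exact mul_le_mul_of_nonneg_left (hyp t htT) (by positivity)
end

section
/- Assume λ₁, λ₂ are as in the context, and suppose there is a constant M > 0 such that λ₁(t)² + λ₂(t)² ≤ M·Δ(t) for all t ∈ (0,T]. Then there exist T' ∈ (0,T] and a constant C > 0 such that ψ(t) ≤ C·Δ̃(t) for all t ∈ (0,T']. -/
open Filter Topology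

/-- Near `0`, the derivative of `t ^ (n + 1) * g t` is `t ^ n * q t` with `q` continuous at `0`. -/
theorem exists_deriv_eventuallyEq_pow_mul {f g : ℝ → ℝ} {n : ℕ} (hg : AnalyticAt ℝ g 0)
    (hf : ∀ᶠ t in 𝓝 (0 : ℝ), f t = t ^ (n + 1) * g t) :
    ∃ q : ℝ → ℝ, ContinuousAt q 0 ∧ q 0 = (n + 1) * g 0 ∧
      ∀ᶠ t in 𝓝 (0 : ℝ), deriv f t = t ^ n * q t := by
  refine ⟨fun t => (n + 1) * g t + t * deriv g t, ?_, by simp, ?_⟩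
  · have := hg.continuousAt
    have := hg.deriv.continuousAt
    fun_prop
  · filter_upwards [hf.eventually_nhds, hg.eventually_analyticAt] with t ht hgt
    have hderiv := (hasDerivAt_pow (n + 1) t).mul hgt.differentiableAt.hasDerivAt
    have heq : f =ᶠ[𝓝 t] (fun x => x ^ (n + 1)) * g := ht
    rw [heq.deriv_eq, hderiv.deriv]
    push_cast
    ring

/-- An analytic function dominated on the right of `0` by `t ^ k * g t` is divisible by `t ^ k`. -/
theorem natCast_le_analyticOrderAt_of_sq_le {s g : ℝ → ℝ} {k : ℕ} {K : ℝ}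
    (hs : AnalyticAt ℝ s 0) (hg : ContinuousAt g 0)
    (hle : ∀ᶠ t in 𝓝[>] (0 : ℝ), s t ^ 2 ≤ K * (t ^ k * g t) ^ 2) :
    (k : ℕ∞) ≤ analyticOrderAt s 0 := by
  by_contra! hlt
  obtain ⟨h, hh, hh0, hsh⟩ := hs.analyticOrderAt_ne_top.1 hlt.ne_top
  set m := analyticOrderNatAt s 0
  have hmk : m < k := by
    rw [← Nat.cast_analyticOrderNatAt hlt.ne_top] at hlt
    exact_mod_cast hlt
  obtain ⟨j, rfl⟩ : ∃ j, k = m + (j + 1) := ⟨k - m - 1, by omega⟩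
  have hbound : ∀ᶠ t in 𝓝[>] (0 : ℝ), h t ^ 2 ≤ K * (t ^ (j + 1) * g t) ^ 2 := by
    filter_upwards [hle, nhdsWithin_le_nhds hsh, self_mem_nhdsWithin] with t h₁ h₂ h₃
    have hpos : 0 < (t ^ m) ^ 2 := pow_pos (pow_pos h₃ m) 2
    refine le_of_mul_le_mul_left ?_ hpos
    simp only [sub_zero, smul_eq_mul] at h₂
    rw [h₂] at h₁
    calc (t ^ m) ^ 2 * h t ^ 2 = (t ^ m * h t) ^ 2 := by ring
      _ ≤ K * (t ^ (m + (j + 1)) * g t) ^ 2 := h₁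
      _ = _ := by ring
  have hcont := hh.continuousAt
  have hl : Tendsto (fun t => h t ^ 2) (𝓝[>] 0) (𝓝 (h 0 ^ 2)) :=
    (hcont.pow 2).tendsto.mono_left nhdsWithin_le_nhds
  have hr : ContinuousAt (fun t => K * (t ^ (j + 1) * g t) ^ 2) 0 := by fun_prop
  have hlim := le_of_tendsto_of_tendsto hl (hr.tendsto.mono_left nhdsWithin_le_nhds) hbound
  exact (pow_pos (abs_pos.2 hh0) 2).not_ge (by simpa using hlim)

/-- If `s² ≤ K d²` to the right of `0`, where `d 0 = 0` and `d` is not identically zero near `0`,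
then the derivatives satisfy an inequality of the same form near `0`. -/
theorem exists_deriv_sq_le_of_sq_le {s d : ℝ → ℝ} {K : ℝ}
    (hs : AnalyticAt ℝ s 0) (hd : AnalyticAt ℝ d 0) (hd0 : d 0 = 0)
    (hne : analyticOrderAt d 0 ≠ ⊤)
    (hle : ∀ᶠ t in 𝓝[>] (0 : ℝ), s t ^ 2 ≤ K * d t ^ 2) :
    ∃ C > (0 : ℝ), ∀ᶠ t in 𝓝 (0 : ℝ), deriv s t ^ 2 ≤ C * deriv d t ^ 2 := by
  obtain ⟨g, hg, hg0, hdg⟩ := hd.analyticOrderAt_ne_top.1 hne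
  have hk : analyticOrderNatAt d 0 ≠ 0 := by
    intro h
    rw [h] at hdg
    apply hg0
    simpa [hd0] using hdg.self_of_nhds.symm
  obtain ⟨n, hn⟩ := Nat.exists_eq_succ_of_ne_zero hk
  simp only [hn, Nat.succ_eq_add_one, sub_zero, smul_eq_mul] at hdg
  have hle' : ∀ᶠ t in 𝓝[>] (0 : ℝ), s t ^ 2 ≤ K * (t ^ (n + 1) * g t) ^ 2 := by
    filter_upwards [hle, nhdsWithin_le_nhds hdg] with t h₁ h₂
    rwa [h₂] at h₁
  obtain ⟨h, hh, hsh⟩ := (natCast_le_analyticOrderAt hs).1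
    (natCast_le_analyticOrderAt_of_sq_le hs hg.continuousAt hle')
  simp only [sub_zero, smul_eq_mul] at hsh
  obtain ⟨p, hp, -, hsp⟩ := exists_deriv_eventuallyEq_pow_mul hh hsh
  obtain ⟨q, hq, hq0, hdq⟩ := exists_deriv_eventuallyEq_pow_mul hg hdg
  have hqpos : 0 < q 0 ^ 2 := by
    have : q 0 ≠ 0 := by
      rw [hq0]
      exact mul_ne_zero (by positivity) hg0
    positivity
  refine ⟨(p 0 ^ 2 + 1) / q 0 ^ 2, by positivity, ?_⟩
  have hlt : ∀ᶠ t in 𝓝 (0 : ℝ), p t ^ 2 < (p 0 ^ 2 + 1) / q 0 ^ 2 * q t ^ 2 := by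
    refine (hp.pow 2).eventually_lt (continuousAt_const.mul (hq.pow 2)) ?_
    simp only [Pi.pow_apply]
    rw [div_mul_cancel₀ _ hqpos.ne']
    linarith
  filter_upwards [hsp, hdq, hlt] with t h₁ h₂ h₃
  rw [h₁, h₂, mul_pow, mul_pow, mul_left_comm]
  gcongr


/-- for `λ₁, λ₂` real-analytic on an open interval containing `[0,T]`,
neither identically zero, with `λ₁(0) = λ₂(0) = 0` and `λ₁ ≠ λ₂` on `(0,T]`, set
`Δ = (λ₁ − λ₂)²`, `Δ̃ = Δ + Δ'²/Δ`, `ψ = (λ₁' + λ₂')²`. If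
`λ₁² + λ₂² ≤ M·Δ` on `(0,T]` for some `M > 0`, then there are `T' ∈ (0,T]` and `C > 0`
with `ψ(t) ≤ C·Δ̃(t)` on `(0,T']`. -/
theorem stmt18 (T u v : ℝ) (hT : 0 < T) (hu : u < 0) (hv : T < v)
    (l1 l2 : ℝ → ℝ)
    (hl1 : AnalyticOnNhd ℝ l1 (Set.Ioo u v))
    (hl2 : AnalyticOnNhd ℝ l2 (Set.Ioo u v))
    (hnz1 : ∃ t ∈ Set.Icc (0 : ℝ) T, l1 t ≠ 0)
    (hnz2 : ∃ t ∈ Set.Icc (0 : ℝ) T, l2 t ≠ 0)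
    (h10 : l1 0 = 0) (h20 : l2 0 = 0)
    (hsep : ∀ t ∈ Set.Ioc (0 : ℝ) T, l1 t ≠ l2 t)
    (M : ℝ) (hM : 0 < M)
    (hyp : ∀ t ∈ Set.Ioc (0 : ℝ) T,
      (l1 t) ^ 2 + (l2 t) ^ 2 ≤ M * (l1 t - l2 t) ^ 2) :
    ∃ T' ∈ Set.Ioc (0 : ℝ) T, ∃ C > (0 : ℝ), ∀ t ∈ Set.Ioc (0 : ℝ) T',
      (deriv l1 t + deriv l2 t) ^ 2 ≤
        C * ((l1 t - l2 t) ^ 2 +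
          (deriv (fun s => (l1 s - l2 s) ^ 2) t) ^ 2 / (l1 t - l2 t) ^ 2) := by
  have h0 : (0 : ℝ) ∈ Set.Ioo u v := ⟨hu, hT.trans hv⟩
  have hright : ∀ᶠ t in 𝓝[>] (0 : ℝ), t ∈ Set.Ioc 0 T := Ioc_mem_nhdsGT hT
  have hne : analyticOrderAt (l1 - l2) 0 ≠ ⊤ := by
    rw [Ne, analyticOrderAt_eq_top]
    intro h
    obtain ⟨t, ht, hmem⟩ := ((h.filter_mono nhdsWithin_le_nhds).and hright).exists
    exact hsep t hmem (sub_eq_zero.1 ht)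
  have hle : ∀ᶠ t in 𝓝[>] (0 : ℝ), (l1 + l2) t ^ 2 ≤ 2 * M * (l1 - l2) t ^ 2 := by
    filter_upwards [hright] with t ht
    simp only [Pi.add_apply, Pi.sub_apply]
    linarith [hyp t ht, sq_nonneg (l1 t - l2 t), add_sq (l1 t) (l2 t), sub_sq (l1 t) (l2 t)]
  obtain ⟨C, hC, hev⟩ := exists_deriv_sq_le_of_sq_le ((hl1 0 h0).add (hl2 0 h0))
    ((hl1 0 h0).sub (hl2 0 h0)) (by simp [h10, h20]) hne hle
  obtain ⟨ε, hε, hball⟩ := Metric.eventually_nhds_iff.1 hev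
  refine ⟨min T (ε / 2), ⟨by positivity, min_le_left _ _⟩, C, hC, fun t ht => ?_⟩
  have htT : t ∈ Set.Ioc 0 T := ⟨ht.1, ht.2.trans (min_le_left _ _)⟩
  have htε : dist t 0 < ε := by
    rw [Real.dist_0_eq_abs, abs_of_pos ht.1]
    linarith [ht.2.trans (min_le_right _ _)]
  have htuv : t ∈ Set.Ioo u v := ⟨hu.trans ht.1, htT.2.trans_lt hv⟩
  have hd1 := (hl1 t htuv).differentiableAt
  have hd2 := (hl2 t htuv).differentiableAt
  have hd : l1 t - l2 t ≠ 0 := sub_ne_zero.2 (hsep t htT)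
  have hmain := hball htε
  rw [deriv_add hd1 hd2, deriv_sub hd1 hd2] at hmain
  have hsq : deriv (fun s => (l1 s - l2 s) ^ 2) t =
      2 * (l1 t - l2 t) * (deriv l1 t - deriv l2 t) := by
    have := ((hd1.hasDerivAt.sub hd2.hasDerivAt).pow 2).deriv
    simp only [Pi.sub_apply, Nat.cast_ofNat, Nat.add_one_sub_one, pow_one] at this
    exact this
  have hquot : (2 * (l1 t - l2 t) * (deriv l1 t - deriv l2 t)) ^ 2 / (l1 t - l2 t) ^ 2 =
      4 * (deriv l1 t - deriv l2 t) ^ 2 := by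
    field_simp
    ring
  rw [hsq, hquot]
  refine hmain.trans (mul_le_mul_of_nonneg_left ?_ hC.le)
  linarith [sq_nonneg (l1 t - l2 t), sq_nonneg (deriv l1 t - deriv l2 t)]
end

section
/- Let S be a set and let λ₁, λ₂, b₁, b₂ : S → ℝ be functions such that |b₂(s)| ≤ C₀ for all s ∈ S and some C₀ > 0, and such that there is M > 0 with λ₁(s)² + λ₂(s)² ≤ M·(λ₁(s) − λ₂(s))² for all s ∈ S. Then the following are equivalent: (1) there exists c > 0 such that b₁(s)² ≤ c·(λ₁(s)² + λ₂(s)²) for all s ∈ S; (2) there exists c > 0 such that (2·b₁(s) + (λ₁(s) + λ₂(s))·b₂(s))² ≤ c·(λ₁(s) − λ₂(s))² for all s ∈ S. -/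
theorem sq_add_mul_le_of_abs_le {x y b C : ℝ} (hb : |b| ≤ C) :
    ((x + y) * b) ^ 2 ≤ 2 * C ^ 2 * (x ^ 2 + y ^ 2) := by
  calc ((x + y) * b) ^ 2 = (x + y) ^ 2 * b ^ 2 := mul_pow _ _ _
    _ ≤ (2 * (x ^ 2 + y ^ 2)) * C ^ 2 :=
        mul_le_mul add_sq_le (sq_le_sq' (abs_le.mp hb).1 (abs_le.mp hb).2) (sq_nonneg b)
          (by positivity)
    _ = 2 * C ^ 2 * (x ^ 2 + y ^ 2) := by ring

/-- comparison of Levi conditions for second order operators: for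
functions `λ₁, λ₂, b₁, b₂ : S → ℝ` with `|b₂| ≤ C₀` and
`λ₁² + λ₂² ≤ M(λ₁ − λ₂)²` on `S`, the condition
`∃ c > 0, b₁² ≤ c(λ₁² + λ₂²)` is equivalent to
`∃ c > 0, (2b₁ + (λ₁ + λ₂)b₂)² ≤ c(λ₁ − λ₂)²`. -/
theorem stmt19 {S : Type*} (l1 l2 b1 b2 : S → ℝ)
    (C₀ : ℝ) (hC₀ : 0 < C₀) (hb2 : ∀ s, |b2 s| ≤ C₀)
    (M : ℝ) (hM : 0 < M)
    (hroots : ∀ s, (l1 s) ^ 2 + (l2 s) ^ 2 ≤ M * (l1 s - l2 s) ^ 2) :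
    (∃ c > (0 : ℝ), ∀ s, (b1 s) ^ 2 ≤ c * ((l1 s) ^ 2 + (l2 s) ^ 2)) ↔
      (∃ c > (0 : ℝ), ∀ s,
        (2 * b1 s + (l1 s + l2 s) * b2 s) ^ 2 ≤ c * (l1 s - l2 s) ^ 2) := by
  constructor
  · rintro ⟨c, hc, h⟩
    refine ⟨(8 * c + 4 * C₀ ^ 2) * M, by positivity, fun s => ?_⟩
    have hy := sq_add_mul_le_of_abs_le (x := l1 s) (y := l2 s) (hb2 s)
    calc (2 * b1 s + (l1 s + l2 s) * b2 s) ^ 2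
        ≤ 2 * ((2 * b1 s) ^ 2 + ((l1 s + l2 s) * b2 s) ^ 2) := add_sq_le
      _ ≤ (8 * c + 4 * C₀ ^ 2) * (l1 s ^ 2 + l2 s ^ 2) := by linarith [h s]
      _ ≤ (8 * c + 4 * C₀ ^ 2) * (M * (l1 s - l2 s) ^ 2) := by gcongr; exact hroots s
      _ = (8 * c + 4 * C₀ ^ 2) * M * (l1 s - l2 s) ^ 2 := by ring
  · rintro ⟨c, hc, h⟩
    refine ⟨c + C₀ ^ 2, by positivity, fun s => ?_⟩
    have hy := sq_add_mul_le_of_abs_le (x := l1 s) (y := l2 s) (hb2 s)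
    have hd : c * (l1 s - l2 s) ^ 2 ≤ c * (2 * (l1 s ^ 2 + l2 s ^ 2)) := by
      gcongr
      linarith [sq_nonneg (l1 s + l2 s)]
    have hsum := sq_nonneg (2 * b1 s + 2 * ((l1 s + l2 s) * b2 s))
    linarith [h s]
end
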